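/- Every compact flat Riemannian manifold has finite blocking number. -/

import Mathlib

open Set Metric Topology
open scoped ENNReal

/-- A unit-speed geodesic segment `γ : [0,a] → M` of (positive) length `a`,
characterized metrically: `γ` is locally an isometric embedding of the
interval `[0,a]` into `M`.  For the geodesic distance of a complete Riemannian
manifold these are exactly the unit-speed geodesic segments. -/
def IsGeodesicSegment {M : Type*} [MetricSpace M] (γ : ℝ → M) (a : ℝ) : Prop :=
  0 < a ∧ ∀ s ∈ Set.Icc (0:ℝ) a, ∃ ε > 0,
    ∀ t ∈ Set.Icc (0:ℝ) a ∩ Set.Icc (s - ε) (s + ε),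
      ∀ t' ∈ Set.Icc (0:ℝ) a ∩ Set.Icc (s - ε) (s + ε),
        dist (γ t) (γ t') = |t' - t|

/-- The set `S` blocks the pair `(x, y)`: every geodesic segment connecting
`x` and `y` contains a point of `S` as an interior point. -/
def Blocks {M : Type*} [MetricSpace M] (S : Set M) (x y : M) : Prop :=
  ∀ (γ : ℝ → M) (a : ℝ), IsGeodesicSegment γ a → γ 0 = x → γ a = y →
    ∃ t ∈ Set.Ioo 0 a, γ t ∈ S

/-- The blocking number `B(x,y)`: the minimal number of points needed to block
all geodesic segments connecting `x` and `y`. -/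
noncomputable def blockingNumber {M : Type*} [MetricSpace M] (x y : M) : ℕ∞ :=
  sInf {n : ℕ∞ | ∃ S : Set M, Blocks S x y ∧ S.encard = n}

/-- The blocking number of the manifold: `B(M,g) = sup { B(x,y) | x, y ∈ M }`. -/
noncomputable def blockingNumberSup (M : Type*) [MetricSpace M] : ℕ∞ :=
  ⨆ (x : M) (y : M), blockingNumber x y

/-- `(M,g)` has finite blocking number (it is *secure*). -/
def HasFiniteBlocking (M : Type*) [MetricSpace M] : Prop :=
  blockingNumberSup M < ⊤

/-- The distance of `M` is the geodesic distance of a (complete) Riemannian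
metric: any two distinct points are joined by a minimizing geodesic segment
(Hopf–Rinow). -/
def GeodesicDistance (M : Type*) [MetricSpace M] : Prop :=
  ∀ x y : M, x ≠ y →
    ∃ γ a, IsGeodesicSegment γ a ∧ γ 0 = x ∧ γ a = y ∧ a = dist x y

/-- `(M,g)` is flat: every point has a metric ball mapped isometrically into
the Euclidean space `ℝⁿ`.  For (the geodesic distance of) a Riemannian
manifold this is equivalent to the identical vanishing of the sectional
(resp. Gaussian) curvature. -/
def IsFlat (M : Type*) [MetricSpace M] (n : ℕ) : Prop :=
  ∀ x : M, ∃ ε > 0, ∃ f : M → EuclideanSpace ℝ (Fin n),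
    ∀ y ∈ Metric.ball x ε, ∀ z ∈ Metric.ball x ε, dist (f y) (f z) = dist y z


section PartA
variable {E : Type*} [NormedAddCommGroup E] [InnerProductSpace ℝ E] [FiniteDimensional ℝ E]

lemma det_poly (A : E →L[ℝ] E) : ∃ p : Polynomial ℝ, p.natDegree ≤ Module.finrank ℝ E ∧
    ∀ t : ℝ, p.eval t = (ContinuousLinearMap.id ℝ E + t • A).det := by
  classical
  let b := Module.finBasis ℝ E
  let B := LinearMap.toMatrix b b (A : E →ₗ[ℝ] E)
  refine ⟨Matrix.det ((Polynomial.X : Polynomial ℝ) • B.map Polynomial.C + (1 : Matrix _ _ ℝ).map Polynomial.C), ?_, ?_⟩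
  · simpa using Polynomial.natDegree_det_X_add_C_le B 1
  · intro t
    rw [← Polynomial.coe_evalRingHom, RingHom.map_det]
    have : (ContinuousLinearMap.id ℝ E + t • A).det = LinearMap.det ((LinearMap.id : E →ₗ[ℝ] E) + t • (A : E →ₗ[ℝ] E)) := rfl
    rw [this, ← LinearMap.det_toMatrix b]
    congr 1
    have h2 : LinearMap.toMatrix b b ((LinearMap.id : E →ₗ[ℝ] E) + t • (A : E →ₗ[ℝ] E)) = 1 + t • B := by
      rw [map_add, map_smul, LinearMap.toMatrix_id]
    rw [h2]
    ext i j
    simp [B, Matrix.one_apply]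
    split_ifs <;> simp <;> ring

lemma det_interp {t0 : ℝ} (h0 : 0 < t0) : ∃ (N : ℕ) (t w : Fin N → ℝ),
    (∀ i, 0 < t i ∧ t i < t0) ∧ ∀ A : E →L[ℝ] E,
      (ContinuousLinearMap.id ℝ E + A).det = ∑ i, w i * (ContinuousLinearMap.id ℝ E + t i • A).det := by
  classical
  let N := Module.finrank ℝ E + 1
  let t : Fin N → ℝ := fun i => t0 / (i + 2)
  have ht : Function.Injective t := by
    intro i j hij
    simp only [t] at hij
    rw [div_eq_div_iff (by positivity) (by positivity)] at hij
    have := mul_left_cancel₀ h0.ne' hij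
    ext
    have : (i:ℝ) = j := by linarith
    exact_mod_cast this
  refine ⟨N, t, fun i => (Lagrange.basis Finset.univ t i).eval 1, ?_, ?_⟩
  · intro i
    refine ⟨by simp only [t]; positivity, ?_⟩
    simp only [t]
    rw [div_lt_iff₀ (by positivity)]
    have : (0:ℝ) ≤ i := by positivity
    nlinarith
  · intro A
    obtain ⟨p, hp, hp'⟩ := det_poly A
    have := Lagrange.eq_interpolate (s := Finset.univ) (v := t) (f := p) ht.injOn (by
      refine lt_of_le_of_lt Polynomial.degree_le_natDegree ?_
      simp [N]
      exact_mod_cast Nat.lt_succ_of_le hp)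
    have h1 := congrArg (Polynomial.eval 1) this
    rw [hp', Lagrange.interpolate_apply, Polynomial.eval_finsetSum] at h1
    rw [one_smul] at h1
    rw [h1]
    refine Finset.sum_congr rfl fun i _ => ?_
    rw [Polynomial.eval_mul, Polynomial.eval_C, hp', mul_comm]

variable [MeasurableSpace E] [BorelSpace E]
open MeasureTheory

lemma vol_const {g : E → E} (hg : ContDiff ℝ 1 g) (h1 : ∀ x, ‖x‖ ≤ 1 → ‖x + g x‖ ≤ 1)
    (h2 : ∀ x, ‖x‖ = 1 → g x = 0) : ∃ t0 > (0:ℝ), ∀ t : ℝ, 0 < t → t < t0 →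
    ∫ x in ball (0:E) 1, (ContinuousLinearMap.id ℝ E + t • fderiv ℝ g x).det = volume.real (ball (0:E) 1) := by
  obtain ⟨K, hK⟩ := hg.contDiffOn.exists_lipschitzOnWith (s := closedBall (0:E) 1) one_ne_zero
    (convex_closedBall _ _) (isCompact_closedBall _ _)
  -- determinant positive
  have hcont : Continuous fun p : ℝ × E => (ContinuousLinearMap.id ℝ E + p.1 • fderiv ℝ g p.2).det := by
    have := hg.continuous_fderiv one_ne_zero
    exact (ContinuousLinearMap.continuous_det (𝕜 := ℝ) (E := E)).comp (by fun_prop)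
  have hpos : ∀ᶠ t in 𝓝 (0:ℝ), ∀ x ∈ closedBall (0:E) 1, 0 < (ContinuousLinearMap.id ℝ E + t • fderiv ℝ g x).det := by
    apply (isCompact_closedBall (0:E) 1).eventually_forall_of_forall_eventually
    intro x hx
    refine (hcont.tendsto (0, x)).eventually (lt_mem_nhds ?_)
    simp [ContinuousLinearMap.det]
  obtain ⟨t1, ht1, ht1'⟩ := Metric.eventually_nhds_iff.1 hpos
  refine ⟨min t1 (min 1 (1 / (K + 1))), by positivity, ?_⟩
  intro t ht htt
  have htt1 : t < t1 := htt.trans_le (min_le_left _ _)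
  have htt2 : t < 1 := htt.trans_le ((min_le_right _ _).trans (min_le_left _ _))
  have htt3 : t * K < 1 := by
    have : t < 1 / (K+1) := htt.trans_le ((min_le_right _ _).trans (min_le_right _ _))
    rw [lt_div_iff₀ (by positivity)] at this
    nlinarith
  have hd : ∀ x ∈ closedBall (0:E) 1, 0 < (ContinuousLinearMap.id ℝ E + t • fderiv ℝ g x).det :=
    ht1' (by simp [abs_of_pos ht, htt1])
  set F : E → E := fun x => x + t • g x with hF
  have hFd : ∀ x, HasStrictFDerivAt F (ContinuousLinearMap.id ℝ E + t • fderiv ℝ g x) x := fun x =>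
    (hasStrictFDerivAt_id x).add ((hg.contDiffAt.hasStrictFDerivAt one_ne_zero).const_smul t)
  have hinj : InjOn F (closedBall (0:E) 1) := by
    intro x hx y hy hxy
    have h3 := hK.dist_le_mul x hx y hy
    have h4 : x - y = t • (g y - g x) := by
      simp only [hF] at hxy
      rw [smul_sub, sub_eq_sub_iff_add_eq_add, hxy, add_comm]
    have h5 : dist x y ≤ t * K * dist x y := by
      rw [dist_eq_norm] at *
      conv_lhs => rw [h4, norm_smul, Real.norm_of_nonneg ht.le, norm_sub_rev, mul_comm]
      rw [dist_eq_norm] at h3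
      nlinarith
    have : dist x y = 0 := by
      by_contra h
      have : 0 < dist x y := lt_of_le_of_ne dist_nonneg (Ne.symm h)
      nlinarith
    exact dist_eq_zero.1 this
  have hmaps : ∀ x ∈ ball (0:E) 1, F x ∈ ball (0:E) 1 := by
    intro x hx
    rw [mem_ball_zero_iff] at *
    have : F x = (1 - t) • x + t • (x + g x) := by simp only [hF]; module
    rw [this]
    refine (norm_add_le _ _).trans_lt ?_
    rw [norm_smul, norm_smul, Real.norm_of_nonneg ht.le, Real.norm_of_nonneg (by linarith)]
    have := h1 x hx.le
    nlinarith
  have hFc : Continuous F := by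
    have := hg.continuous
    fun_prop
  have hopen : IsOpen (F '' ball 0 1) := by
    rw [isOpen_iff_mem_nhds]
    rintro _ ⟨x, hx, rfl⟩
    have hsurj : (ContinuousLinearMap.id ℝ E + t • fderiv ℝ g x).range = ⊤ := by
      have h := (hd x (ball_subset_closedBall hx)).ne'
      exact LinearMap.range_eq_top.2 ((LinearMap.equivOfDetNeZero (ContinuousLinearMap.id ℝ E + t • fderiv ℝ g x : E →ₗ[ℝ] E) h).surjective)
    rw [← (hFd x).map_nhds_eq_of_surj hsurj]
    exact Filter.image_mem_map (isOpen_ball.mem_nhds hx)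
  have himg : F '' ball 0 1 = ball (0:E) 1 := by
    apply Subset.antisymm
    · rintro _ ⟨x, hx, rfl⟩; exact hmaps x hx
    · have hpre : IsPreconnected (ball (0:E) 1) := (convex_ball _ _).isPreconnected
      refine hpre.subset_of_closure_inter_subset hopen ?_ ?_
      · exact ⟨F 0, hmaps 0 (by simp), mem_image_of_mem _ (by simp)⟩
      · rintro y ⟨hy, hy1⟩
        have hcl : IsClosed (F '' closedBall 0 1) := ((isCompact_closedBall _ _).image hFc).isClosed
        have : y ∈ F '' closedBall 0 1 := 
          closure_minimal (image_mono ball_subset_closedBall) hcl hy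
        obtain ⟨x, hx, rfl⟩ := this
        refine ⟨x, ?_, rfl⟩
        rw [mem_closedBall_zero_iff] at hx
        rw [mem_ball_zero_iff]
        refine lt_of_le_of_ne hx fun h => ?_
        have : F x = x := by simp [hF, h2 x h]
        rw [this, mem_ball_zero_iff] at hy1
        linarith
  have hcv := integral_image_eq_integral_abs_det_fderiv_smul (volume : Measure E) measurableSet_ball
    (fun x _ => (hFd x).hasFDerivAt.hasFDerivWithinAt) (hinj.mono ball_subset_closedBall) (fun _ => (1:ℝ))
  rw [himg] at hcv
  simp only [integral_const, smul_eq_mul, mul_one, measureReal_restrict_apply_univ] at hcv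
  rw [hcv]
  refine setIntegral_congr_fun measurableSet_ball fun x hx => ?_
  exact (abs_of_pos (hd x (ball_subset_closedBall hx))).symm

theorem no_retract {f : E → E} (hf : ContDiff ℝ 1 f) (h1 : ∀ x, ‖x‖ ≤ 1 → ‖f x‖ = 1)
    (h2 : ∀ x, ‖x‖ = 1 → f x = x) : False := by
  set g : E → E := fun x => f x - x with hgdef
  have hg : ContDiff ℝ 1 g := hf.sub contDiff_id
  obtain ⟨t0, ht0, ht⟩ := vol_const (g := g) hg (fun x hx => by simp [hgdef, h1 x hx]) 
    (fun x hx => by simp [hgdef, h2 x hx])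
  obtain ⟨N, t, w, htt, hw⟩ := det_interp (E := E) ht0
  have hint : ∀ s : ℝ, IntegrableOn (fun x => (ContinuousLinearMap.id ℝ E + s • fderiv ℝ g x).det) (ball 0 1) := by
    intro s
    have hc : Continuous (fun x => (ContinuousLinearMap.id ℝ E + s • fderiv ℝ g x).det) := by
      have := hg.continuous_fderiv one_ne_zero
      exact (ContinuousLinearMap.continuous_det (𝕜 := ℝ) (E := E)).comp (by fun_prop)
    exact (hc.continuousOn.integrableOn_compact (isCompact_closedBall 0 1)).mono_set ball_subset_closedBall
  have hsum : ∑ i, w i = 1 := by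
    have := hw 0
    simpa [ContinuousLinearMap.det] using this.symm
  have key : ∫ x in ball (0:E) 1, (ContinuousLinearMap.id ℝ E + fderiv ℝ g x).det = volume.real (ball (0:E) 1) := by
    rw [setIntegral_congr_fun measurableSet_ball (fun x _ => hw (fderiv ℝ g x))]
    rw [integral_finsetSum _ (fun i _ => (hint (t i)).const_mul _)]
    simp_rw [integral_const_mul, ht _ (htt _).1 (htt _).2]
    rw [← Finset.sum_mul, hsum, one_mul]
  have hzero : ∀ x ∈ ball (0:E) 1, (ContinuousLinearMap.id ℝ E + fderiv ℝ g x).det = 0 := by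
    intro x hx
    have hfd : HasFDerivAt f (ContinuousLinearMap.id ℝ E + fderiv ℝ g x) x := by
      have := (hasFDerivAt_id x).add (hg.differentiable one_ne_zero x).hasFDerivAt
      refine this.congr_of_eventuallyEq (Filter.Eventually.of_forall fun y => ?_)
      simp [hgdef]
    set A := ContinuousLinearMap.id ℝ E + fderiv ℝ g x
    have hin : ∀ v, inner ℝ (f x) (A v) = 0 := by
      intro v
      have h3 := (hfd.inner ℝ hfd)
      have h4 : (fun y => inner ℝ (f y) (f y)) =ᶠ[𝓝 x] fun _ => (1:ℝ) := by
        filter_upwards [isOpen_ball.mem_nhds hx] with y hy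
        rw [real_inner_self_eq_norm_sq, h1 y (by simpa using (mem_ball_zero_iff.1 hy).le)]; norm_num
      have h5 := (hasFDerivAt_const (𝕜 := ℝ) (1:ℝ) x).congr_of_eventuallyEq h4
      have h6 := congrArg (fun L => L v) (h3.unique h5)
      simp [fderivInnerCLM_apply] at h6
      rw [real_inner_comm] at h6
      have : inner ℝ (f x) (A v) = inner ℝ (A v) (f x) := real_inner_comm _ _
      linarith
    by_contra h
    obtain ⟨v, hv⟩ := (LinearMap.equivOfDetNeZero (A : E →ₗ[ℝ] E) h).surjective (f x)
    have hv' : A v = f x := hv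
    have := hin v
    rw [hv', real_inner_self_eq_norm_sq, h1 x (by simpa using (mem_ball_zero_iff.1 hx).le)] at this
    norm_num at this
  rw [setIntegral_congr_fun measurableSet_ball (fun x hx => hzero x hx)] at key
  simp at key
  have : 0 < volume.real (ball (0:E) 1) := ENNReal.toReal_pos (measure_ball_pos _ _ one_pos).ne' measure_ball_lt_top.ne
  linarith

end PartA

section PartB
variable {E : Type*} [NormedAddCommGroup E] [InnerProductSpace ℝ E] [FiniteDimensional ℝ E]
variable [MeasurableSpace E] [BorelSpace E]

lemma exists_zero_of_near_id {H : E → E} (hH : ContinuousOn H (closedBall 0 1))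
    (h : ∀ x ∈ closedBall (0:E) 1, ‖H x - x‖ ≤ 1 / 2) : ∃ x ∈ closedBall (0:E) 1, H x = 0 := by
  by_contra! hne
  set ρ : E → E := fun x => (max 1 ‖x‖)⁻¹ • x with hρ
  have hmaxpos : ∀ x : E, 0 < max 1 ‖x‖ := fun x => lt_max_of_lt_left one_pos
  have hρc : Continuous ρ := by
    have : Continuous fun x : E => (max 1 ‖x‖)⁻¹ :=
      Continuous.inv₀ (by fun_prop) (fun x => (hmaxpos x).ne')
    fun_prop
  have hρm : ∀ x, ρ x ∈ closedBall (0:E) 1 := by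
    intro x
    rw [mem_closedBall_zero_iff, hρ]
    simp only [norm_smul, norm_inv]
    rw [Real.norm_of_nonneg (hmaxpos x).le, inv_mul_le_iff₀ (hmaxpos x)]
    simp
  have hρid : ∀ x ∈ closedBall (0:E) 1, ρ x = x := by
    intro x hx
    rw [mem_closedBall_zero_iff] at hx
    simp [hρ, max_eq_left hx]
  have hHc : Continuous (H ∘ ρ) := hH.comp_continuous hρc hρm
  obtain ⟨x0, hx0, hmin⟩ := (isCompact_closedBall (0:E) 1).exists_isMinOn ⟨0, by simp⟩ hH.norm
  have hδ : 0 < ‖H x0‖ := norm_pos_iff.2 (hne x0 hx0)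
  obtain ⟨g, hg, hgd, -⟩ := hHc.exists_contDiff_approx (ε := fun _ => min ‖H x0‖ (1/10)) 1
    continuous_const (fun _ => by positivity)
  have hg1 : ∀ x ∈ closedBall (0:E) 1, g x ≠ 0 := by
    intro x hx h0
    have h3 := hgd x
    rw [h0, Function.comp, hρid x hx, dist_zero_left] at h3
    have := hmin hx
    simp only [mem_ofPred_eq] at this
    exact absurd (h3.trans_le (min_le_left _ _)) (not_lt.2 this)
  have hg2 : ∀ x ∈ closedBall (0:E) 1, ‖g x - x‖ ≤ 6/10 := by
    intro x hx
    have h3 := (hgd x).trans_le (min_le_right _ _)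
    rw [Function.comp, hρid x hx, dist_eq_norm] at h3
    have h4 := h x hx
    have : g x - x = (g x - H x) + (H x - x) := by abel
    rw [this]
    refine (norm_add_le _ _).trans ?_
    linarith
  let χ : ContDiffBump (0:E) := ⟨7/10, 9/10, by norm_num, by norm_num⟩
  set K : E → E := fun x => x + χ x • (g x - x) with hK
  have hg' : ContDiff ℝ 1 g := hg
  have hKc : ContDiff ℝ 1 K := contDiff_id.add (χ.contDiff.smul (hg'.sub contDiff_id))
  have hKout : ∀ x : E, 9/10 ≤ ‖x‖ → K x = x := by
    intro x hx
    have : χ x = 0 := χ.zero_of_le_dist (by simpa [χ] using hx)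
    simp [hK, this]
  have hK0 : ∀ x, K x ≠ 0 := by
    intro x
    by_cases h1 : ‖x‖ ≤ 7/10
    · have : χ x = 1 := χ.one_of_mem_closedBall (by simpa [χ] using h1)
      simp only [hK, this, one_smul, add_sub_cancel]
      exact hg1 x (by rw [mem_closedBall_zero_iff]; linarith)
    · push Not at h1
      by_cases h2 : 9/10 ≤ ‖x‖
      · rw [hKout x h2]
        intro h3
        rw [h3, norm_zero] at h2
        norm_num at h2
      · push Not at h2
        intro h3
        have h4 : x = -(χ x • (g x - x)) := eq_neg_of_add_eq_zero_left h3
        have h5 : ‖x‖ ≤ 6/10 := by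
          conv_lhs => rw [h4]
          rw [norm_neg, norm_smul, Real.norm_of_nonneg χ.nonneg]
          have := hg2 x (by rw [mem_closedBall_zero_iff]; linarith)
          have h6 : χ x ≤ 1 := χ.le_one
          have h7 : 0 ≤ χ x := χ.nonneg
          nlinarith [norm_nonneg (g x - x)]
        linarith
  refine no_retract (f := fun x => ‖K x‖⁻¹ • K x) ?_ ?_ ?_
  · exact ((hKc.norm ℝ hK0).inv (fun x => norm_ne_zero_iff.2 (hK0 x))).smul hKc
  · intro x _
    rw [norm_smul, norm_inv, norm_norm, inv_mul_cancel₀ (norm_ne_zero_iff.2 (hK0 x))]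
  · intro x hx
    rw [hKout x (by rw [hx]; norm_num), hx]
    simp

open MeasureTheory in
theorem invariance_of_domain {f : E → E} (hf : ContinuousOn f (closedBall 0 1))
    (hinj : InjOn f (closedBall 0 1)) : f '' closedBall 0 1 ∈ 𝓝 (f 0) := by
  have : CompactSpace (closedBall (0:E) 1) := isCompact_iff_compactSpace.1 (isCompact_closedBall _ _)
  have he : IsClosedEmbedding (fun x : closedBall (0:E) 1 => f x) :=
    (continuousOn_iff_continuous_domRestrict.1 hf).isClosedEmbedding (fun x y hxy => Subtype.ext (hinj x.2 y.2 hxy))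
  obtain ⟨G, hG⟩ := ContinuousMap.exists_extension he (⟨Subtype.val, continuous_subtype_val⟩ : C(closedBall (0:E) 1, E))
  have hGf : ∀ x ∈ closedBall (0:E) 1, G (f x) = x := fun x hx => congrArg (fun g => g ⟨x, hx⟩) hG
  have h0 : (0:E) ∈ closedBall (0:E) 1 := by simp
  by_contra hnot
  obtain ⟨ε0, hε0, hε0'⟩ := Metric.continuousAt_iff.1 (G.continuous.continuousAt (x := f 0)) (1/10) (by norm_num)
  rw [hGf 0 h0] at hε0'
  rw [Metric.mem_nhds_iff] at hnot
  push Not at hnot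
  have hεp : 0 < ε0 / 2 := by positivity
  obtain ⟨c, hc1, hc2⟩ := not_subset.1 (hnot (ε0/2) hεp)
  set ε := ε0 / 2 with hε
  have hGsmall : ∀ y, dist y c ≤ ε → ‖G y‖ < 1/10 := by
    intro y hy
    have := hε0' (x := y) (by
      have := dist_triangle y c (f 0)
      rw [mem_ball] at hc1
      linarith)
    simpa using this
  have himg : IsCompact (f '' closedBall 0 1) := (isCompact_closedBall _ _).image_of_continuousOn hf
  obtain ⟨δ, hδ, hδ'⟩ : ∃ δ > 0, ∀ y ∈ f '' closedBall 0 1, ε ≤ dist y c → δ ≤ ‖G y‖ := by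
    have hcpt : IsCompact (f '' closedBall 0 1 ∩ {y | ε ≤ dist y c}) :=
      himg.inter_right (isClosed_le continuous_const (by fun_prop))
    rcases (f '' closedBall 0 1 ∩ {y | ε ≤ dist y c}).eq_empty_or_nonempty with hemp | hnem
    · refine ⟨1, one_pos, fun y hy hy' => ?_⟩
      have : y ∈ (f '' closedBall 0 1 ∩ {y | ε ≤ dist y c}) := ⟨hy, hy'⟩
      rw [hemp] at this
      exact this.elim
    · obtain ⟨y0, ⟨hy0, hy0'⟩, hm⟩ := hcpt.exists_isMinOn hnem (f := fun y => ‖G y‖) (by fun_prop)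
      refine ⟨‖G y0‖, ?_, fun y hy hy' => hm ⟨hy, hy'⟩⟩
      refine norm_pos_iff.2 ?_
      obtain ⟨x, hx, rfl⟩ := hy0
      rw [hGf x hx]
      rintro rfl
      rw [mem_ball, dist_comm] at hc1
      simp only [mem_ofPred_eq] at hy0'
      linarith
  obtain ⟨P, hP, hPd, -⟩ := G.continuous.exists_contDiff_approx (ε := fun _ => min (δ/2) (1/10)) 1
    continuous_const (fun _ => by positivity)
  have hnull : volume (P '' sphere c ε) = 0 :=
    addHaar_image_eq_zero_of_differentiableOn_of_addHaar_eq_zero volume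
      ((ContDiff.differentiable hP (by norm_num)).differentiableOn) (Measure.addHaar_sphere_of_ne_zero volume c hεp.ne')
  obtain ⟨w, hw1, hw2⟩ : ∃ w ∈ ball (0:E) (min (δ/2) (1/10)), w ∉ P '' sphere c ε := by
    by_contra! hcon
    have h3 := measure_mono_null (μ := volume) (show ball (0:E) (min (δ/2) (1/10)) ⊆ _ from hcon) hnull
    exact (measure_ball_pos volume (0:E) (r := min (δ/2) (1/10)) (by positivity)).ne' h3
  rw [mem_ball_zero_iff] at hw1
  have hPG : ∀ y, ‖(P y - w) - G y‖ < δ ∧ ‖(P y - w) - G y‖ < 2/10 := by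
    intro y
    have h3 := hPd y
    rw [dist_eq_norm] at h3
    have h4 : ‖(P y - w) - G y‖ ≤ ‖P y - G y‖ + ‖w‖ := by
      have : (P y - w) - G y = (P y - G y) - w := by abel
      rw [this]; exact norm_sub_le _ _
    rw [lt_min_iff] at h3 hw1
    constructor <;> linarith
  have hfc : ∀ x ∈ closedBall (0:E) 1, 0 < ‖f x - c‖ := by
    intro x hx
    rw [norm_pos_iff, sub_ne_zero]
    rintro rfl
    exact hc2 ⟨x, hx, rfl⟩
  set Φ : E → E := fun y => c + max (ε / ‖y - c‖) 1 • (y - c) with hΦ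
  have hΦ1 : ∀ y, ε ≤ ‖y - c‖ → Φ y = y := by
    intro y hy
    have : ε / ‖y - c‖ ≤ 1 := by rw [div_le_one (hεp.trans_le hy)]; exact hy
    simp [hΦ, max_eq_right this]
  have hΦ2 : ∀ y, 0 < ‖y - c‖ → ‖y - c‖ < ε → Φ y ∈ sphere c ε := by
    intro y hy hy'
    have : 1 ≤ ε / ‖y - c‖ := by rw [one_le_div hy]; exact hy'.le
    rw [mem_sphere, dist_eq_norm]
    simp only [hΦ, max_eq_left this, add_sub_cancel_left, norm_smul]
    rw [Real.norm_of_nonneg (by positivity), div_mul_cancel₀ _ hy.ne']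
  obtain ⟨x, hx, hx0⟩ := exists_zero_of_near_id (H := fun x => P (Φ (f x)) - w) (by
    have h3 : ContinuousOn (fun x => Φ (f x)) (closedBall 0 1) := by
      have h4 : ContinuousOn (fun x => ε / ‖f x - c‖) (closedBall 0 1) :=
        continuousOn_const.div (hf.sub continuousOn_const).norm (fun x hx => (hfc x hx).ne')
      exact continuousOn_const.add ((h4.sup continuousOn_const).smul (hf.sub continuousOn_const))
    exact (hP.continuous.comp_continuousOn h3).sub continuousOn_const) (by
    intro x hx
    by_cases h3 : ε ≤ ‖f x - c‖
    · have h4 := (hPG (f x)).2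
      rw [hGf x hx] at h4
      simp only [hΦ1 _ h3]
      linarith
    · push Not at h3
      have h4 := hΦ2 _ (hfc x hx) h3
      have h5 := hGsmall _ (mem_sphere.1 h4).le
      have h6 := hGsmall (f x) (by rw [dist_eq_norm]; exact h3.le)
      rw [hGf x hx] at h6
      have h7 := (hPG (Φ (f x))).2
      have h8 : P (Φ (f x)) - w - x = (P (Φ (f x)) - w - G (Φ (f x))) + G (Φ (f x)) - x := by abel
      rw [h8]
      refine (norm_sub_le _ _).trans ?_
      have := norm_add_le (P (Φ (f x)) - w - G (Φ (f x))) (G (Φ (f x)))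
      linarith)
  by_cases h3 : ε ≤ ‖f x - c‖
  · rw [hΦ1 _ h3] at hx0
    have h4 := (hPG (f x)).1
    rw [hx0, zero_sub, norm_neg] at h4
    have := hδ' (f x) ⟨x, hx, rfl⟩ (by rw [dist_eq_norm]; exact h3)
    linarith
  · push Not at h3
    exact hw2 ⟨_, hΦ2 _ (hfc x hx) h3, sub_eq_zero.1 hx0⟩

end PartB

section PartC

/-- uniformly sized Euclidean balls. -/
def UnifFlat (M E : Type*) [MetricSpace M] [MetricSpace E] (r : ℝ) : Prop :=
  ∀ x : M, ∃ f : M → E, (∀ y ∈ ball x r, ∀ z ∈ ball x r, dist (f y) (f z) = dist y z) ∧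
    ball (f x) r ⊆ f '' ball x r

theorem image_mem_nhds_of_flat {n : ℕ} {M : Type*} [MetricSpace M]
    [ChartedSpace (EuclideanSpace ℝ (Fin n)) M] {x : M} {ε : ℝ} (hε : 0 < ε)
    {f : M → EuclideanSpace ℝ (Fin n)}
    (hf : ∀ y ∈ ball x ε, ∀ z ∈ ball x ε, dist (f y) (f z) = dist y z) :
    f '' ball x ε ∈ 𝓝 (f x) := by
  set e := chartAt (EuclideanSpace ℝ (Fin n)) x
  have hx : x ∈ e.source := mem_chart_source _ x
  have hU : e.target ∩ e.symm ⁻¹' (ball x ε) ∈ 𝓝 (e x) := by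
    refine Filter.inter_mem (e.open_target.mem_nhds (e.map_source hx)) ?_
    apply (e.continuousAt_symm (e.map_source hx)).preimage_mem_nhds
    rw [e.left_inv hx]
    exact ball_mem_nhds _ hε
  obtain ⟨ρ, hρ, hρ'⟩ := Metric.nhds_basis_closedBall.mem_iff.1 hU
  have hmem : ∀ z ∈ closedBall (0 : EuclideanSpace ℝ (Fin n)) 1,
      e x + ρ • z ∈ e.target ∩ e.symm ⁻¹' (ball x ε) := by
    intro z hz
    apply hρ'
    rw [mem_closedBall_zero_iff] at hz
    rw [mem_closedBall, dist_eq_norm, add_sub_cancel_left, norm_smul, Real.norm_of_nonneg hρ.le]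
    nlinarith
  have hfc : ContinuousOn f (ball x ε) := by
    have : LipschitzOnWith 1 f (ball x ε) := LipschitzOnWith.of_dist_le_mul fun y hy z hz => by
      rw [hf y hy z hz]; simp
    exact this.continuousOn
  have := invariance_of_domain (f := fun z => f (e.symm (e x + ρ • z))) (by
    refine hfc.comp ?_ (fun z hz => (hmem z hz).2)
    refine e.continuousOn_symm.comp (by fun_prop) (fun z hz => (hmem z hz).1)) (by
    intro z hz w hw hzw
    have h1 : dist (e.symm (e x + ρ • z)) (e.symm (e x + ρ • w)) = 0 := by
      rw [← hf _ (hmem z hz).2 _ (hmem w hw).2]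
      simp only at hzw
      rw [hzw, dist_self]
    have h2 := e.symm.injOn (hmem z hz).1 (hmem w hw).1 (dist_eq_zero.1 h1)
    exact smul_right_injective _ hρ.ne' (add_left_cancel h2))
  simp only [smul_zero, add_zero, e.left_inv hx] at this
  refine Filter.mem_of_superset this ?_
  rintro _ ⟨z, hz, rfl⟩
  exact ⟨_, (hmem z hz).2, rfl⟩

theorem exists_unifFlat {n : ℕ} {M : Type*} [MetricSpace M] [CompactSpace M]
    [ChartedSpace (EuclideanSpace ℝ (Fin n)) M] (hflat : IsFlat M n) :
    ∃ r > 0, UnifFlat M (EuclideanSpace ℝ (Fin n)) r := by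
  suffices h : ∃ r > (0:ℝ), ∀ ρ, 0 < ρ → ρ ≤ r → ∀ x ∈ (univ : Set M), ∃ f : M → EuclideanSpace ℝ (Fin n),
      (∀ y ∈ ball x ρ, ∀ z ∈ ball x ρ, dist (f y) (f z) = dist y z) ∧
      ball (f x) ρ ⊆ f '' ball x ρ by
    obtain ⟨r, hr, h⟩ := h
    exact ⟨r, hr, fun x => h r hr le_rfl x trivial⟩
  refine isCompact_univ.induction_on (p := fun s => ∃ r > (0:ℝ), ∀ ρ, 0 < ρ → ρ ≤ r → ∀ x ∈ s,
      ∃ f : M → EuclideanSpace ℝ (Fin n),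
      (∀ y ∈ ball x ρ, ∀ z ∈ ball x ρ, dist (f y) (f z) = dist y z) ∧
      ball (f x) ρ ⊆ f '' ball x ρ) ?_ ?_ ?_ ?_
  · exact ⟨1, one_pos, fun ρ _ _ x hx => hx.elim⟩
  · rintro s t hst ⟨r, hr, h⟩
    exact ⟨r, hr, fun ρ h1 h2 x hx => h ρ h1 h2 x (hst hx)⟩
  · rintro s t ⟨r, hr, h⟩ ⟨r', hr', h'⟩
    refine ⟨min r r', lt_min hr hr', fun ρ h1 h2 x hx => ?_⟩
    rcases hx with hx | hx
    · exact h ρ h1 (h2.trans (min_le_left _ _)) x hx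
    · exact h' ρ h1 (h2.trans (min_le_right _ _)) x hx
  · intro x _
    obtain ⟨ε, hε, f, hf⟩ := hflat x
    obtain ⟨δ0, hδ0, hδ0'⟩ := Metric.mem_nhds_iff.1 (image_mem_nhds_of_flat hε hf)
    set δ := min δ0 ε
    have hδ : 0 < δ := lt_min hδ0 hε
    have hδε : δ ≤ ε := min_le_right _ _
    have hδ' : ball (f x) δ ⊆ f '' ball x ε := (ball_subset_ball (min_le_left _ _)).trans hδ0'
    refine ⟨ball x (δ/2), mem_nhdsWithin_of_mem_nhds (ball_mem_nhds _ (by positivity)), δ/2, by positivity, ?_⟩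
    intro ρ hρ hρδ y hy
    have hsub : ball y ρ ⊆ ball x ε := ball_subset_ball' (by rw [mem_ball] at hy; linarith)
    have hyε : y ∈ ball x ε := hsub (mem_ball_self hρ)
    have hxε : x ∈ ball x ε := mem_ball_self hε
    refine ⟨f, fun z hz w hw => hf z (hsub hz) w (hsub hw), ?_⟩
    intro p hp
    have hp' : p ∈ ball (f x) δ := by
      rw [mem_ball] at *
      have := dist_triangle p (f y) (f x)
      rw [hf y hyε x hxε] at this
      linarith
    obtain ⟨z, hz, rfl⟩ := hδ' hp'
    refine ⟨z, ?_, rfl⟩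
    rw [mem_ball, hf z hz y hyε] at hp
    exact hp

end PartC

section PartD
variable {E : Type*} [NormedAddCommGroup E] [InnerProductSpace ℝ E] [FiniteDimensional ℝ E]

lemma exists_affine_ext {h : E → E} {v : E} {s : ℝ} (hs : 0 < s)
    (hh : ∀ x ∈ ball v s, ∀ y ∈ ball v s, dist (h x) (h y) = dist x y) :
    ∃ g : E ≃ᵃⁱ[ℝ] E, ∀ x ∈ ball v s, h x = g x := by
  set q : E → E := fun x => h (v + x) - h v with hq
  have hvm : v ∈ ball v s := mem_ball_self hs
  have hm : ∀ x, ‖x‖ < s → v + x ∈ ball v s := fun x hx => by simpa [mem_ball, dist_eq_norm] using hx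
  have hqn : ∀ x, ‖x‖ < s → ‖q x‖ = ‖x‖ := fun x hx => by
    have := hh _ (hm x hx) _ hvm
    rw [dist_eq_norm, dist_eq_norm] at this
    simpa [hq] using this
  have hqd : ∀ x y, ‖x‖ < s → ‖y‖ < s → ‖q x - q y‖ = ‖x - y‖ := fun x y hx hy => by
    have := hh _ (hm x hx) _ (hm y hy)
    rw [dist_eq_norm, dist_eq_norm] at this
    simpa [hq] using this
  have hqi : ∀ x y, ‖x‖ < s → ‖y‖ < s → inner ℝ (q x) (q y) = inner ℝ x y := fun x y hx hy => by
    rw [real_inner_eq_norm_mul_self_add_norm_mul_self_sub_norm_sub_mul_self_div_two,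
      real_inner_eq_norm_mul_self_add_norm_mul_self_sub_norm_sub_mul_self_div_two,
      hqn x hx, hqn y hy, hqd x y hx hy]
  let b := stdOrthonormalBasis ℝ E
  have hbs : ∀ i, ‖(s/2) • b i‖ < s := fun i => by
    rw [norm_smul, b.norm_eq_one, Real.norm_of_nonneg (by positivity)]; linarith
  let c : Fin (Module.finrank ℝ E) → E := fun i => (2/s) • q ((s/2) • b i)
  have hcq : ∀ i x, ‖x‖ < s → inner ℝ (c i) (q x) = inner ℝ (b i) x := fun i x hx => by
    simp only [c]
    rw [real_inner_smul_left, hqi _ _ (hbs i) hx, real_inner_smul_left, ← mul_assoc]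
    have : 2 / s * (s / 2) = 1 := by field_simp
    rw [this, one_mul]
  have hco : Orthonormal ℝ c := by
    rw [orthonormal_iff_ite]
    intro i j
    have : inner ℝ (c i) (c j) = (2/s) * inner ℝ (c i) (q ((s/2) • b j)) := by
      simp only [c]
      rw [real_inner_smul_right]
    rw [this, hcq i _ (hbs j), real_inner_smul_right, ← mul_assoc, orthonormal_iff_ite.1 b.orthonormal i j]
    have : 2 / s * (s / 2) = 1 := by field_simp
    rw [this, one_mul]
  have hspan : ⊤ ≤ Submodule.span ℝ (range c) := by
    rw [hco.linearIndependent.span_eq_top_of_card_eq_finrank' (by simp)]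
  let c' := OrthonormalBasis.mk hco hspan
  let L : E ≃ₗᵢ[ℝ] E := b.equiv c' (Equiv.refl _)
  have hLb : ∀ i, L (b i) = c i := fun i => by simp [L, c']
  have hL : ∀ x, ‖x‖ < s → q x = L x := by
    intro x hx
    refine InnerProductSpace.ext_inner_left_basis (𝕜 := ℝ) c'.toBasis fun i => ?_
    have : c'.toBasis i = c i := by simp [c']
    rw [this, hcq i x hx, ← hLb i, L.inner_map_map]
  refine ⟨AffineIsometryEquiv.mk' (fun x => L (x - v) + h v) L v (fun x => by simp), ?_⟩
  intro x hx
  rw [mem_ball, dist_eq_norm] at hx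
  have := hL (x - v) hx
  simp [hq] at this ⊢
  rw [← this]; abel

lemma affine_unique {g g' : E ≃ᵃⁱ[ℝ] E} {a : E} (h : ∀ᶠ x in 𝓝 a, g x = g' x) : g = g' := by
  ext1 x
  have hc : Filter.Tendsto (fun t : ℝ => AffineMap.lineMap a x t) (𝓝[>] 0) (𝓝 a) := by
    have : Continuous fun t : ℝ => (AffineMap.lineMap a x t : E) := AffineMap.lineMap_continuous
    have h2 := this.tendsto 0
    simp only [AffineMap.lineMap_apply_zero] at h2
    exact h2.mono_left nhdsWithin_le_nhds
  obtain ⟨t, ht, ht0⟩ := ((hc.eventually h).and self_mem_nhdsWithin).exists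
  have ha : g a = g' a := h.self_of_nhds
  have e1 : ∀ k : E ≃ᵃⁱ[ℝ] E, k (AffineMap.lineMap a x t) = AffineMap.lineMap (k a) (k x) t := fun k =>
    k.toAffineEquiv.toAffineMap.apply_lineMap a x t
  rw [e1, e1, ha, AffineMap.lineMap_apply, AffineMap.lineMap_apply] at ht
  have ht' := add_right_cancel ht
  exact sub_left_injective (smul_right_injective _ (ne_of_gt ht0) ht')

end PartD

section PartF
variable {E : Type*} [NormedAddCommGroup E] [InnerProductSpace ℝ E] [FiniteDimensional ℝ E]
variable {M : Type*} [MetricSpace M]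

def LocIsom (π : E → M) (W : Set E) : Prop :=
  ∀ v ∈ W, ∃ s > 0, ∀ x ∈ ball v s, ∀ y ∈ ball v s, dist (π x) (π y) = dist x y

lemma LocIsom.mono {π : E → M} {W W' : Set E} (h : LocIsom π W) (hW : W' ⊆ W) : LocIsom π W' :=
  fun v hv => h v (hW hv)

lemma locIsom_of_isom {π : E → M} {v : E} {r : ℝ}
    (h : ∀ x ∈ ball v r, ∀ y ∈ ball v r, dist (π x) (π y) = dist x y) : LocIsom π (ball v r) := by
  intro w hw
  obtain ⟨s, hs, hs'⟩ := Metric.isOpen_iff.1 isOpen_ball w hw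
  exact ⟨s, hs, fun x hx y hy => h x (hs' hx) y (hs' hy)⟩

variable {r : ℝ}

lemma unique_cont (hr : 0 < r) (hM : UnifFlat M E r) {π π' : E → M} {W : Set E} (hW : IsPreconnected W)
    (h : LocIsom π W) (h' : LocIsom π' W) {a : E} (ha : a ∈ W) (haa : ∀ᶠ x in 𝓝 a, π x = π' x) :
    ∀ x ∈ W, π x = π' x := by
  suffices hsub : W ⊆ {v | ∀ᶠ x in 𝓝 v, π x = π' x} from fun x hx => (hsub hx).self_of_nhds
  refine hW.subset_of_closure_inter_subset isOpen_setOfPred_eventually_nhds ⟨a, ha, haa⟩ ?_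
  rintro v ⟨hvc, hv⟩
  obtain ⟨s1, hs1, h1⟩ := h v hv
  obtain ⟨s2, hs2, h2⟩ := h' v hv
  set s := min (min s1 s2) r
  have hs : 0 < s := lt_min (lt_min hs1 hs2) hr
  have hss1 : s ≤ s1 := (min_le_left _ _).trans (min_le_left _ _)
  have hss2 : s ≤ s2 := (min_le_left _ _).trans (min_le_right _ _)
  have hsr : s ≤ r := min_le_right _ _
  obtain ⟨b, hb, hbv⟩ := Metric.mem_closure_iff.1 hvc (s/4) (by positivity)
  have hbv' : b ∈ ball v (s/4) := by rwa [mem_ball, dist_comm]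
  obtain ⟨f, hf, -⟩ := hM (π v)
  have sub1 : ball v (s/4) ⊆ ball v s1 := ball_subset_ball (by linarith)
  have sub2 : ball v (s/4) ⊆ ball v s2 := ball_subset_ball (by linarith)
  have hvv : v ∈ ball v (s/4) := mem_ball_self (by positivity)
  have m1 : ∀ x ∈ ball v (s/4), π x ∈ ball (π v) r := by
    intro x hx
    rw [mem_ball, h1 x (sub1 hx) v (sub1 hvv)]
    rw [mem_ball] at hx
    linarith
  have hbeq : π b = π' b := Filter.Eventually.self_of_nhds (x := b) (p := fun x => π x = π' x) hb
  have m2 : ∀ x ∈ ball v (s/4), π' x ∈ ball (π v) r := by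
    intro x hx
    rw [mem_ball]
    have e1 := dist_triangle (π' x) (π' b) (π v)
    rw [h2 x (sub2 hx) b (sub2 hbv'), ← hbeq, h1 b (sub1 hbv') v (sub1 hvv)] at e1
    have e2 := dist_triangle x v b
    rw [mem_ball] at hx hbv'
    rw [dist_comm b v] at *
    linarith
  obtain ⟨g1, hg1⟩ := exists_affine_ext (h := f ∘ π) (v := v) (s := s/4) (by positivity) (by
    intro x hx y hy
    rw [Function.comp, Function.comp, hf _ (m1 x hx) _ (m1 y hy), h1 x (sub1 hx) y (sub1 hy)])
  obtain ⟨g2, hg2⟩ := exists_affine_ext (h := f ∘ π') (v := v) (s := s/4) (by positivity) (by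
    intro x hx y hy
    rw [Function.comp, Function.comp, hf _ (m2 x hx) _ (m2 y hy), h2 x (sub2 hx) y (sub2 hy)])
  have hg : g1 = g2 := by
    refine affine_unique (a := b) ?_
    filter_upwards [hb, isOpen_ball.mem_nhds hbv'] with x hx hx'
    rw [← hg1 x hx', ← hg2 x hx', Function.comp, Function.comp, hx]
  have hnb : ball v (s/4) ∈ 𝓝 v := ball_mem_nhds _ (by positivity)
  show ∀ᶠ x in 𝓝 v, π x = π' x
  filter_upwards [hnb] with x hx
  rw [← dist_eq_zero, ← hf _ (m1 x hx) _ (m2 x hx)]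
  have e1 := hg1 x hx
  have e2 := hg2 x hx
  simp only [Function.comp] at e1 e2
  rw [e1, e2, hg, dist_self]

lemma exists_chart (hr : 0 < r) (hM : UnifFlat M E r) {π : E → M} {W : Set E} (h : LocIsom π W)
    {v : E} (hv : v ∈ W) : ∃ ψ : E → M, (∀ x ∈ ball v r, ∀ y ∈ ball v r, dist (ψ x) (ψ y) = dist x y) ∧
      ψ '' ball v r = ball (π v) r ∧ ∀ᶠ x in 𝓝 v, ψ x = π x := by
  obtain ⟨s1, hs1, h1⟩ := h v hv
  set s := min s1 r
  have hs : 0 < s := lt_min hs1 hr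
  have hss1 : s ≤ s1 := min_le_left _ _
  have hsr : s ≤ r := min_le_right _ _
  obtain ⟨f, hf, hfs⟩ := hM (π v)
  have sub1 : ball v s ⊆ ball v s1 := ball_subset_ball (by linarith)
  have hvv : v ∈ ball v s := mem_ball_self (by positivity)
  have m1 : ∀ x ∈ ball v s, π x ∈ ball (π v) r := by
    intro x hx
    rw [mem_ball, h1 x (sub1 hx) v (sub1 hvv)]
    rw [mem_ball] at hx
    linarith
  obtain ⟨g, hg⟩ := exists_affine_ext (h := f ∘ π) (v := v) (s := s) hs (by
    intro x hx y hy
    rw [Function.comp, Function.comp, hf _ (m1 x hx) _ (m1 y hy), h1 x (sub1 hx) y (sub1 hy)])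
  have : Nonempty M := ⟨π v⟩
  have hgv : g v = f (π v) := (hg v hvv).symm
  set ψ : E → M := fun x => Function.invFunOn f (ball (π v) r) (g x) with hψ
  have hmem : ∀ x ∈ ball v r, g x ∈ f '' ball (π v) r := by
    intro x hx
    apply hfs
    rw [mem_ball, ← hgv, g.dist_map]
    exact hx
  have a1 : ∀ x ∈ ball v r, ψ x ∈ ball (π v) r := fun x hx => Function.invFunOn_mem (hmem x hx)
  have a2 : ∀ x ∈ ball v r, f (ψ x) = g x := fun x hx => Function.invFunOn_eq (hmem x hx)
  have finj : ∀ y ∈ ball (π v) r, ∀ z ∈ ball (π v) r, f y = f z → y = z := by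
    intro y hy z hz hyz
    rw [← dist_eq_zero, ← hf y hy z hz, hyz, dist_self]
  refine ⟨ψ, ?_, ?_, ?_⟩
  · intro x hx y hy
    rw [← hf _ (a1 x hx) _ (a1 y hy), a2 x hx, a2 y hy, g.dist_map]
  · apply Subset.antisymm
    · rintro _ ⟨x, hx, rfl⟩
      exact a1 x hx
    · intro y hy
      have hx : g.symm (f y) ∈ ball v r := by
        rw [mem_ball, ← g.dist_map, g.apply_symm_apply, hgv, hf y hy _ (mem_ball_self hr)]
        exact hy
      refine ⟨g.symm (f y), hx, ?_⟩
      apply finj _ (a1 _ hx) _ hy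
      rw [a2 _ hx, g.apply_symm_apply]
  · filter_upwards [ball_mem_nhds v hs] with x hx
    have hx' : x ∈ ball v r := ball_subset_ball hsr hx
    apply finj _ (a1 x hx') _ (m1 x hx)
    rw [a2 x hx', ← hg x hx]
    rfl

lemma exists_chart_convex (hr : 0 < r) (hM : UnifFlat M E r) {π : E → M} {W : Set E} (h : LocIsom π W)
    (hW : Convex ℝ W) {v : E} (hv : v ∈ W) :
    ∃ ψ : E → M, (∀ x ∈ ball v r, ∀ y ∈ ball v r, dist (ψ x) (ψ y) = dist x y) ∧
      ψ '' ball v r = ball (π v) r ∧ ∀ x ∈ ball v r ∩ W, ψ x = π x := by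
  obtain ⟨ψ, h1, h2, h3⟩ := exists_chart hr hM h hv
  refine ⟨ψ, h1, h2, ?_⟩
  exact unique_cont hr hM ((convex_ball _ _).inter hW).isPreconnected
    ((locIsom_of_isom h1).mono inter_subset_left) (h.mono inter_subset_right)
    ⟨mem_ball_self hr, hv⟩ h3

lemma extend_step (hr : 0 < r) (hM : UnifFlat M E r) {R : ℝ} (hR : 0 < R) {π : E → M}
    (h : LocIsom π (ball 0 R)) : ∃ π' : E → M, LocIsom π' (ball 0 (R + r/2)) ∧ ∀ x ∈ ball (0:E) R, π' x = π x := by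
  have : ∀ v : E, ∃ ψ : E → M, v ∈ ball (0:E) R → (∀ x ∈ ball v r, ∀ y ∈ ball v r, dist (ψ x) (ψ y) = dist x y) ∧
      ψ '' ball v r = ball (π v) r ∧ ∀ x ∈ ball v r ∩ ball 0 R, ψ x = π x := by
    intro v
    by_cases hv : v ∈ ball (0:E) R
    · obtain ⟨ψ, hψ⟩ := exists_chart_convex hr hM h (convex_ball _ _) hv
      exact ⟨ψ, fun _ => hψ⟩
    · exact ⟨π, fun h => absurd h hv⟩
  choose ψ hψ using this
  set k : ℝ := R / (R + r/2) with hk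
  have hk0 : 0 < k := by positivity
  have hk1 : k < 1 := by rw [hk, div_lt_one (by positivity)]; linarith
  have hkR : k * (R + r/2) = R := by rw [hk]; field_simp
  have hc : ∀ w ∈ ball (0:E) (R + r/2), k • w ∈ ball (0:E) R := by
    intro w hw
    rw [mem_ball_zero_iff] at *
    rw [norm_smul, Real.norm_of_nonneg hk0.le]
    nlinarith
  have hcw : ∀ w ∈ ball (0:E) (R + r/2), dist w (k • w) < r/2 := by
    intro w hw
    rw [mem_ball_zero_iff] at *
    have : w - k • w = (1 - k) • w := by module
    rw [dist_eq_norm, this, norm_smul, Real.norm_of_nonneg (by linarith)]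
    nlinarith
  refine ⟨fun w => ψ (k • w) w, ?_, ?_⟩
  · intro w0 hw0
    -- near w0 the map equals `ψ (k • w0)`
    have key : ∀ w ∈ ball (0:E) (R + r/2), dist w w0 < r/4 → ψ (k • w) w = ψ (k • w0) w := by
      intro w hw hww
      have hkd : dist (k • w) (k • w0) < r/4 := by
        rw [dist_smul₀, Real.norm_of_nonneg hk0.le]
        nlinarith [dist_nonneg (x := w) (y := w0)]
      obtain ⟨i1, -, e1⟩ := hψ _ (hc w hw)
      obtain ⟨i2, -, e2⟩ := hψ _ (hc w0 hw0)
      have hm0 : k • w0 ∈ ball (k • w) r ∩ ball (k • w0) r :=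
        ⟨by rw [mem_ball, dist_comm]; linarith, mem_ball_self hr⟩
      refine unique_cont hr hM (W := ball (k • w) r ∩ ball (k • w0) r)
        ((convex_ball _ _).inter (convex_ball _ _)).isPreconnected
        ((locIsom_of_isom i1).mono inter_subset_left) ((locIsom_of_isom i2).mono inter_subset_right)
        hm0 ?_ w ⟨?_, ?_⟩
      · filter_upwards [(isOpen_ball.inter isOpen_ball).mem_nhds hm0, isOpen_ball.mem_nhds (hc w0 hw0)] with x hx hx'
        rw [e1 x ⟨hx.1, hx'⟩, e2 x ⟨hx.2, hx'⟩]
      · rw [mem_ball]; linarith [hcw w hw]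
      · rw [mem_ball]
        linarith [dist_triangle w w0 (k • w0), hcw w0 hw0]
    obtain ⟨s, hs, hs'⟩ := Metric.mem_nhds_iff.1 (Filter.inter_mem (isOpen_ball.mem_nhds hw0) (ball_mem_nhds w0 (show 0 < r/4 by positivity)))
    obtain ⟨i2, -, e2⟩ := hψ _ (hc w0 hw0)
    have hin : ∀ x ∈ ball w0 s, x ∈ ball (k • w0) r := by
      intro x hx
      have := (hs' hx).2
      rw [mem_ball] at *
      linarith [dist_triangle x w0 (k • w0), hcw w0 hw0]
    refine ⟨s, hs, fun x hx y hy => ?_⟩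
    beta_reduce
    rw [key x (hs' hx).1 (hs' hx).2, key y (hs' hy).1 (hs' hy).2]
    exact i2 x (hin x hx) y (hin y hy)
  · intro x hx
    have hx' : x ∈ ball (0:E) (R + r/2) := ball_subset_ball (by linarith) hx
    obtain ⟨-, -, e⟩ := hψ _ (hc x hx')
    exact e x ⟨by rw [mem_ball]; linarith [hcw x hx'], hx⟩

theorem exists_developing [Nonempty M] (hr : 0 < r) (hM : UnifFlat M E r) :
    ∃ π : E → M, LocIsom π univ := by
  obtain ⟨x0⟩ := ‹Nonempty M›
  have base : ∃ π : E → M, LocIsom π (ball 0 r) := by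
    obtain ⟨f, hf, hfs⟩ := hM x0
    have : Nonempty M := ⟨x0⟩
    have hmem : ∀ x ∈ ball (0:E) r, x + f x0 ∈ f '' ball x0 r := by
      intro x hx
      apply hfs
      simpa [mem_ball, dist_eq_norm] using hx
    refine ⟨fun x => Function.invFunOn f (ball x0 r) (x + f x0), locIsom_of_isom ?_⟩
    intro x hx y hy
    rw [← hf _ (Function.invFunOn_mem (hmem x hx)) _ (Function.invFunOn_mem (hmem y hy)),
      Function.invFunOn_eq (hmem x hx), Function.invFunOn_eq (hmem y hy), dist_add_right]
  obtain ⟨π0, hπ0⟩ := base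
  let Rk : ℕ → ℝ := fun k => r + k * (r/2)
  have hRk : ∀ k, 0 < Rk k := fun k => by positivity
  have hstep : ∀ k (p : {π : E → M // LocIsom π (ball 0 (Rk k))}),
      ∃ p' : {π : E → M // LocIsom π (ball 0 (Rk (k+1)))}, ∀ x ∈ ball (0:E) (Rk k), p'.1 x = p.1 x := by
    rintro k ⟨p, hp⟩
    obtain ⟨p', h1, h2⟩ := extend_step hr hM (hRk k) hp
    have : Rk (k+1) = Rk k + r/2 := by simp only [Rk]; push_cast; ring
    exact ⟨⟨p', this ▸ h1⟩, h2⟩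
  choose next hnext using hstep
  let seq : (k : ℕ) → {π : E → M // LocIsom π (ball 0 (Rk k))} := fun k =>
    Nat.rec ⟨π0, by simpa [Rk] using hπ0⟩ (fun k p => next k p) k
  have hseq : ∀ k, ∀ x ∈ ball (0:E) (Rk k), (seq (k+1)).1 x = (seq k).1 x := fun k => hnext k (seq k)
  have hmono : ∀ j k, j ≤ k → Rk j ≤ Rk k := by
    intro j k hjk
    have : (j:ℝ) ≤ k := by exact_mod_cast hjk
    simp only [Rk]; nlinarith
  have hagree : ∀ j k, j ≤ k → ∀ x ∈ ball (0:E) (Rk j), (seq k).1 x = (seq j).1 x := by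
    intro j k hjk x hx
    induction k, hjk using Nat.le_induction with
    | base => rfl
    | succ k hjk ih => rw [hseq k x (ball_subset_ball (hmono j k hjk) hx), ih]
  let κ : E → ℕ := fun x => ⌈‖x‖ / (r/2)⌉₊
  have hκ : ∀ x, x ∈ ball (0:E) (Rk (κ x)) := by
    intro x
    rw [mem_ball_zero_iff]
    have := Nat.le_ceil (‖x‖ / (r/2))
    rw [div_le_iff₀ (by positivity)] at this
    simp only [Rk, κ]
    linarith
  have hfin : ∀ k, ∀ x ∈ ball (0:E) (Rk k), (seq (κ x)).1 x = (seq k).1 x := by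
    intro k x hx
    rcases le_total (κ x) k with h | h
    · exact (hagree _ _ h x (hκ x)).symm
    · exact hagree _ _ h x hx
  refine ⟨fun x => (seq (κ x)).1 x, ?_⟩
  intro v _
  obtain ⟨s, hs, h⟩ := (seq (κ v)).2 v (hκ v)
  obtain ⟨s', hs', h'⟩ := Metric.isOpen_iff.1 isOpen_ball v (hκ v)
  refine ⟨min s s', lt_min hs hs', fun x hx y hy => ?_⟩
  have hx1 := ball_subset_ball (min_le_left s s') hx
  have hy1 := ball_subset_ball (min_le_left s s') hy
  have hx2 := h' (ball_subset_ball (min_le_right s s') hx)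
  have hy2 := h' (ball_subset_ball (min_le_right s s') hy)
  simp only [hfin _ x hx2, hfin _ y hy2]
  exact h x hx1 y hy1

/-- A Riemannian-type covering: isometric from balls of radius `r` onto balls. -/
def IsCov (π : E → M) (r : ℝ) : Prop :=
  ∀ v, (∀ x ∈ ball v r, ∀ y ∈ ball v r, dist (π x) (π y) = dist x y) ∧ π '' ball v r = ball (π v) r

theorem exists_cov [Nonempty M] (hr : 0 < r) (hM : UnifFlat M E r) : ∃ π : E → M, IsCov π r := by
  obtain ⟨π, hπ⟩ := exists_developing (E := E) hr hM
  refine ⟨π, fun v => ?_⟩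
  obtain ⟨ψ, h1, h2, h3⟩ := exists_chart_convex hr hM hπ convex_univ (mem_univ v)
  have h4 : ∀ x ∈ ball v r, ψ x = π x := fun x hx => h3 x ⟨hx, trivial⟩
  constructor
  · intro x hx y hy
    rw [← h4 x hx, ← h4 y hy, h1 x hx y hy]
  · rw [← h2]
    exact (image_congr h4).symm

lemma IsCov.locIsom {π : E → M} (hr : 0 < r) (h : IsCov π r) (W : Set E) : LocIsom π W :=
  fun v _ => ⟨r, hr, (h v).1⟩

lemma IsCov.continuous {π : E → M} (hr : 0 < r) (h : IsCov π r) : Continuous π := by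
  rw [Metric.continuous_iff]
  intro b ε hε
  refine ⟨min ε r, lt_min hε hr, fun a ha => ?_⟩
  rw [(h b).1 a (ha.trans_le (min_le_right _ _)) b (mem_ball_self hr)]
  exact ha.trans_le (min_le_left _ _)

lemma IsCov.surjective [ConnectedSpace M] {π : E → M} (hr : 0 < r) (h : IsCov π r) : Function.Surjective π := by
  have hb : ∀ v, ball (π v) r ⊆ range π := fun v => by
    rw [← (h v).2]; exact image_subset_range _ _
  have hcl : IsClopen (range π) := by
    refine ⟨⟨?_⟩, ?_⟩
    · rw [Metric.isOpen_iff]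
      intro y hy
      refine ⟨r, hr, fun z hz hz' => hy ?_⟩
      obtain ⟨v, rfl⟩ := hz'
      exact hb v (by rwa [mem_ball, dist_comm])
    · rw [Metric.isOpen_iff]
      rintro _ ⟨v, rfl⟩
      exact ⟨r, hr, hb v⟩
  rw [← range_eq_univ]
  exact hcl.eq_univ (range_nonempty _)

lemma IsCov.cocompact [ConnectedSpace M] [CompactSpace M] {π : E → M} (hr : 0 < r) (h : IsCov π r) :
    ∃ D > 0, ∀ y, ∃ v, ‖v‖ < D ∧ π v = y := by
  have hopen : ∀ k : ℕ, IsOpen (π '' ball (0:E) k) := by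
    intro k
    rw [isOpen_iff_mem_nhds]
    rintro _ ⟨v, hv, rfl⟩
    obtain ⟨s, hs, hs'⟩ := Metric.isOpen_iff.1 isOpen_ball v hv
    have hm : 0 < min s r := lt_min hs hr
    refine Metric.mem_nhds_iff.2 ⟨min s r, hm, fun y hy => ?_⟩
    have hy2 := ball_subset_ball (min_le_right s r) hy
    rw [← (h v).2] at hy2
    obtain ⟨x, hx, rfl⟩ := hy2
    refine ⟨x, hs' ?_, rfl⟩
    rw [mem_ball, (h v).1 x hx v (mem_ball_self hr)] at hy
    exact hy.trans_le (min_le_left _ _)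
  have hcov : (univ : Set M) ⊆ ⋃ k : ℕ, π '' ball (0:E) k := by
    intro y _
    obtain ⟨v, rfl⟩ := h.surjective hr y
    obtain ⟨k, hk⟩ := exists_nat_gt ‖v‖
    exact mem_iUnion.2 ⟨k, v, by simpa using hk, rfl⟩
  obtain ⟨k, hk⟩ := isCompact_univ.elim_directed_cover _ hopen hcov
    (directed_of_isDirected_le fun i j hij => image_mono (ball_subset_ball (by exact_mod_cast hij)))
  refine ⟨k + 1, by positivity, fun y => ?_⟩
  obtain ⟨v, hv, rfl⟩ := hk (mem_univ y)
  rw [mem_ball_zero_iff] at hv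
  exact ⟨v, by linarith, rfl⟩

/-- deck transformations -/
def Deck (π : E → M) : Subgroup (E ≃ᵃⁱ[ℝ] E) where
  carrier := {g | ∀ x, π (g x) = π x}
  mul_mem' := by
    intro a b ha hb x
    rw [AffineIsometryEquiv.coe_mul, Function.comp, ha, hb]
  one_mem' := fun x => rfl
  inv_mem' := by
    intro a ha x
    rw [← ha (a⁻¹ x)]
    congr 1
    exact a.apply_symm_apply x

lemma IsCov.exists_deck {π : E → M} (hr : 0 < r) (hM : UnifFlat M E r) (h : IsCov π r) {u v : E} (huv : π u = π v) :
    ∃ g ∈ Deck π, g u = v := by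
  have hex : ∀ x ∈ ball u r, ∃ y ∈ ball v r, π y = π x := by
    intro x hx
    have : π x ∈ π '' ball v r := by
      rw [(h v).2, ← huv, ← (h u).2]
      exact mem_image_of_mem _ hx
    exact this
  choose! q hq1 hq2 using hex
  obtain ⟨g, hg⟩ := exists_affine_ext (h := q) (v := u) hr (by
    intro x hx y hy
    rw [← (h v).1 _ (hq1 x hx) _ (hq1 y hy), hq2 x hx, hq2 y hy, (h u).1 x hx y hy])
  refine ⟨g, ?_, ?_⟩
  · have hcomp : LocIsom (π ∘ g) univ := by
      intro x _
      refine ⟨r, hr, fun a ha b hb => ?_⟩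
      rw [Function.comp, Function.comp, (h (g x)).1 _ (by simpa [mem_ball] using ha) _ (by simpa [mem_ball] using hb), g.dist_map]
    intro x
    refine unique_cont hr hM isPreconnected_univ hcomp (h.locIsom hr univ) (mem_univ u) ?_ x trivial
    filter_upwards [ball_mem_nhds u hr] with x hx
    rw [Function.comp, ← hg x hx, hq2 x hx]
  · rw [← hg u (mem_ball_self hr)]
    have h1 := hq1 u (mem_ball_self hr)
    have h2 := hq2 u (mem_ball_self hr)
    rw [← dist_eq_zero, ← (h v).1 _ h1 _ (mem_ball_self hr), h2, huv, dist_self]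

lemma IsCov.deck_free {π : E → M} (hr : 0 < r) (h : IsCov π r) {g : E ≃ᵃⁱ[ℝ] E} (hg : g ∈ Deck π)
    {v : E} (hv : dist (g v) v < r) : g = 1 := by
  have h1 : ∀ x, dist (g x) x < r → g x = x := by
    intro x hx
    rw [← dist_eq_zero, ← (h x).1 _ hx _ (mem_ball_self hr), hg x, dist_self]
  refine affine_unique (a := v) ?_
  have hc : Continuous fun x => dist (g x) x := g.continuous.dist continuous_id
  filter_upwards [hc.continuousAt.eventually_lt continuousAt_const hv] with x hx
  exact h1 x hx

end PartF

section PartG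
variable {E : Type*} [NormedAddCommGroup E] [InnerProductSpace ℝ E] [FiniteDimensional ℝ E]
variable {M : Type*} [MetricSpace M] {r : ℝ}

lemma IsCov.local_lift {π : E → M} (hr : 0 < r) (h : IsCov π r) {γ : ℝ → M} {a : ℝ}
    (hγ : IsGeodesicSegment γ a) {s : ℝ} (hs : s ∈ Icc 0 a) {w : E} (hw : π w = γ s) :
    ∃ ε > 0, ∃ v : E, ∀ t ∈ Icc 0 a ∩ Icc (s - ε) (s + ε), γ t = π (w + (t - s) • v) := by
  obtain ⟨ha, hγ'⟩ := hγ
  obtain ⟨ε', hε', hiso⟩ := hγ' s hs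
  set ε := min ε' (r/2) with hεdef
  have hε : 0 < ε := lt_min hε' (by positivity)
  have hεε' : ε ≤ ε' := min_le_left _ _
  have hεr : ε ≤ r/2 := min_le_right _ _
  set J := Icc 0 a ∩ Icc (s - ε) (s + ε) with hJ
  have hJsub : J ⊆ Icc 0 a ∩ Icc (s - ε') (s + ε') :=
    inter_subset_inter_right _ (Icc_subset_Icc (by linarith) (by linarith))
  have hsJ : s ∈ J := ⟨hs, by constructor <;> linarith⟩
  have hex : ∀ t ∈ J, ∃ x ∈ ball w r, π x = γ t := by
    intro t ht
    have : γ t ∈ π '' ball w r := by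
      rw [(h w).2, hw, mem_ball, hiso t (hJsub ht) s (hJsub hsJ), abs_lt]
      constructor <;> linarith [ht.2.1, ht.2.2]
    exact this
  choose! p hp1 hp2 using hex
  have hpd : ∀ t ∈ J, ∀ t' ∈ J, dist (p t) (p t') = |t' - t| := by
    intro t ht t' ht'
    rw [← (h w).1 _ (hp1 t ht) _ (hp1 t' ht'), hp2 t ht, hp2 t' ht', hiso t (hJsub ht) t' (hJsub ht')]
  have hps : p s = w := by
    rw [← dist_eq_zero, ← (h w).1 _ (hp1 s hsJ) _ (mem_ball_self hr), hp2 s hsJ, hw, dist_self]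
  set α := max 0 (s - ε) with hα
  set β := min a (s + ε) with hβ
  have hJeq : ∀ t, t ∈ J ↔ α ≤ t ∧ t ≤ β := by
    intro t
    simp only [hJ, hα, hβ, mem_inter_iff, mem_Icc, max_le_iff, le_min_iff]
    tauto
  have hαβ : α < β := by
    rw [hα, hβ, max_lt_iff, lt_min_iff, lt_min_iff]
    refine ⟨⟨ha, ?_⟩, ?_, ?_⟩ <;> linarith [hs.1, hs.2]
  have hαJ : α ∈ J := (hJeq α).2 ⟨le_rfl, hαβ.le⟩
  have hβJ : β ∈ J := (hJeq β).2 ⟨hαβ.le, le_rfl⟩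
  have hβα : 0 < β - α := sub_pos.2 hαβ
  have hline : ∀ t ∈ J, p t = p α + (t - α) • ((β - α)⁻¹ • (p β - p α)) := by
    intro t ht
    have htt := (hJeq t).1 ht
    have := eq_lineMap_of_dist_eq_mul_of_dist_eq_mul (x := p α) (y := p t) (z := p β) (r := (t - α)/(β - α)) 
      (by rw [hpd _ hαJ _ ht, hpd _ hαJ _ hβJ, abs_of_pos hβα, abs_of_nonneg (by linarith)]; field_simp)
      (by
        rw [hpd _ ht _ hβJ, hpd _ hαJ _ hβJ, abs_of_pos hβα, abs_of_nonneg (by linarith), sub_mul, div_mul_cancel₀ _ hβα.ne']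
        ring)
    rw [this, AffineMap.lineMap_apply, vsub_eq_sub, vadd_eq_add, smul_smul, div_eq_mul_inv, add_comm]
  refine ⟨ε, hε, (β - α)⁻¹ • (p β - p α), fun t ht => ?_⟩
  rw [← hp2 t ht, hline t ht, ← hps, hline s hsJ]
  congr 1
  module

theorem IsCov.lift_geodesic {π : E → M} (hr : 0 < r) (h : IsCov π r) {γ : ℝ → M} {a : ℝ}
    (hγ : IsGeodesicSegment γ a) {u : E} (hu : π u = γ 0) :
    ∃ v : E, ∀ t ∈ Icc 0 a, γ t = π (u + t • v) := by
  have ha : 0 < a := hγ.1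
  obtain ⟨ε0, hε0, v, hv⟩ := h.local_lift hr hγ (s := 0) ⟨le_rfl, ha.le⟩ hu
  refine ⟨v, ?_⟩
  by_contra! hcon
  set F := {t | t ∈ Icc 0 a ∧ γ t ≠ π (u + t • v)} with hF
  have hFne : F.Nonempty := hcon
  have hFb : BddBelow F := ⟨0, fun t ht => ht.1.1⟩
  set T := sInf F with hT
  have hTle : ∀ t ∈ F, T ≤ t := fun t ht => csInf_le hFb ht
  have hlow : ∀ t, 0 ≤ t → t < T → t ≤ a → γ t = π (u + t • v) := by
    intro t h0 htT hta
    by_contra hne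
    exact absurd (hTle t ⟨⟨h0, hta⟩, hne⟩) (not_le.2 htT)
  have hT0 : ε0 ≤ T := by
    refine le_csInf hFne fun t ht => ?_
    by_contra hlt
    push Not at hlt
    apply ht.2
    have := hv t ⟨ht.1, by constructor <;> linarith [ht.1.1]⟩
    simpa using this
  have hTpos : 0 < T := lt_of_lt_of_le hε0 hT0
  obtain ⟨t1, ht1⟩ := hFne
  have hTa : T ≤ a := (hTle t1 ht1).trans ht1.1.2
  have hTm : T ∈ Icc 0 a := ⟨hTpos.le, hTa⟩
  -- the point at time T
  have hnv : 0 < ‖v‖ + 1 := by positivity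
  have hTeq : π (u + T • v) = γ T := by
    obtain ⟨ε, hε, hiso⟩ := hγ.2 T hTm
    by_contra hne
    have hd : 0 < dist (π (u + T • v)) (γ T) := dist_pos.2 hne
    set d := dist (π (u + T • v)) (γ T)
    set η := min (min ε T) (min (r / (2 * (‖v‖ + 1))) (d / (2 * (‖v‖ + 1)))) with hη
    have hηp : 0 < η := by positivity
    have e1 : η ≤ ε := (min_le_left _ _).trans (min_le_left _ _)
    have e2 : η ≤ T := (min_le_left _ _).trans (min_le_right _ _)
    have e3 : η * (‖v‖ + 1) ≤ r / 2 := by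
      have : η ≤ r / (2 * (‖v‖ + 1)) := (min_le_right _ _).trans (min_le_left _ _)
      rw [le_div_iff₀ (by positivity)] at this
      linarith
    have e4 : η * (‖v‖ + 1) ≤ d / 2 := by
      have : η ≤ d / (2 * (‖v‖ + 1)) := (min_le_right _ _).trans (min_le_right _ _)
      rw [le_div_iff₀ (by positivity)] at this
      linarith
    have f1 : γ (T - η) = π (u + (T - η) • v) := hlow _ (by linarith) (by linarith) (by linarith)
    have f2 : dist (γ (T - η)) (γ T) = η := by
      rw [hiso (T - η) ⟨⟨by linarith, by linarith⟩, by linarith, by linarith⟩ T ⟨hTm, by linarith, by linarith⟩]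
      rw [sub_sub_cancel, abs_of_pos hηp]
    have f3 : dist (u + T • v) (u + (T - η) • v) = η * ‖v‖ := by
      rw [dist_eq_norm]
      have : u + T • v - (u + (T - η) • v) = η • v := by module
      rw [this, norm_smul, Real.norm_of_nonneg hηp.le]
    have f4 : dist (π (u + T • v)) (π (u + (T - η) • v)) = η * ‖v‖ := by
      rw [dist_comm, (h (u + T • v)).1 _ _ _ (mem_ball_self hr), dist_comm, f3]
      rw [mem_ball, dist_comm, f3]
      nlinarith
    have f5 := dist_triangle (π (u + T • v)) (π (u + (T - η) • v)) (γ T)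
    rw [f4, ← f1, f2] at f5
    have : d ≤ η * ‖v‖ + η := f5
    nlinarith
  obtain ⟨ε, hε, v', hv'⟩ := h.local_lift hr hγ hTm hTeq
  have hvv : v' = v := by
    set η := min (min ε T) (r / (2 * (‖v‖ + ‖v'‖ + 1))) with hη
    have hηp : 0 < η := by positivity
    have e1 : η ≤ ε := (min_le_left _ _).trans (min_le_left _ _)
    have e2 : η ≤ T := (min_le_left _ _).trans (min_le_right _ _)
    have e3 : η * (‖v‖ + ‖v'‖ + 1) ≤ r / 2 := by
      have : η ≤ r / (2 * (‖v‖ + ‖v'‖ + 1)) := min_le_right _ _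
      rw [le_div_iff₀ (by positivity)] at this
      linarith
    have f1 : γ (T - η) = π (u + (T - η) • v) := hlow _ (by linarith) (by linarith) (by linarith)
    have f2 := hv' (T - η) ⟨⟨by linarith, by linarith⟩, by linarith, by linarith⟩
    have g1 : u + (T - η) • v ∈ ball (u + T • v) r := by
      rw [mem_ball, dist_eq_norm]
      have : u + (T - η) • v - (u + T • v) = -(η • v) := by module
      rw [this, norm_neg, norm_smul, Real.norm_of_nonneg hηp.le]
      nlinarith [norm_nonneg v, norm_nonneg v', mul_nonneg hηp.le (norm_nonneg v')]
    have g2 : u + T • v + (T - η - T) • v' ∈ ball (u + T • v) r := by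
      rw [mem_ball, dist_eq_norm]
      have : u + T • v + (T - η - T) • v' - (u + T • v) = -(η • v') := by module
      rw [this, norm_neg, norm_smul, Real.norm_of_nonneg hηp.le]
      nlinarith [norm_nonneg v, norm_nonneg v', mul_nonneg hηp.le (norm_nonneg v)]
    have g3 : u + T • v + (T - η - T) • v' = u + (T - η) • v := by
      rw [← dist_eq_zero, ← (h _).1 _ g2 _ g1, ← f2, ← f1, dist_self]
    have g4 : η • v' = η • v := by
      have e1 : η • v' = u + T • v - (u + T • v + (T - η - T) • v') := by module
      rw [e1, g3]; module
    exact smul_right_injective _ hηp.ne' g4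
  rw [hvv] at hv'
  obtain ⟨t, ht, htlt⟩ := exists_lt_of_csInf_lt ⟨t1, ht1⟩ (show sInf F < T + ε by linarith)
  have htT := hTle t ht
  apply ht.2
  rw [hv' t ⟨ht.1, by constructor <;> linarith⟩]
  congr 1
  module

end PartG

section PartH
open Filter

variable {E : Type*} [NormedAddCommGroup E] [InnerProductSpace ℝ E]

/-- The linear part of an affine isometry. -/
noncomputable def LP (g : E ≃ᵃⁱ[ℝ] E) : E →L[ℝ] E :=
  (g.linearIsometryEquiv.toContinuousLinearEquiv : E →L[ℝ] E)

lemma LP_apply (g : E ≃ᵃⁱ[ℝ] E) (v : E) : LP g v = g v - g 0 := by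
  have := g.map_vadd 0 v
  simp only [vadd_eq_add, add_zero] at this
  rw [this]
  simp [LP]

lemma LP_eq (g : E ≃ᵃⁱ[ℝ] E) (v : E) : g v = LP g v + g 0 := by
  rw [LP_apply]; abel

lemma LP_sub (g : E ≃ᵃⁱ[ℝ] E) (v w : E) : g v - g w = LP g (v - w) := by
  rw [map_sub, LP_apply, LP_apply]; abel

lemma LP_norm (g : E ≃ᵃⁱ[ℝ] E) (v : E) : ‖LP g v‖ = ‖v‖ := by
  rw [LP_apply, ← dist_eq_norm, g.dist_map, dist_zero_right]

lemma LP_opnorm (g : E ≃ᵃⁱ[ℝ] E) : ‖LP g‖ ≤ 1 :=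
  ContinuousLinearMap.opNorm_le_bound _ zero_le_one fun x => by rw [LP_norm, one_mul]

lemma LP_mul (g h : E ≃ᵃⁱ[ℝ] E) (v : E) : LP (g * h) v = LP g (LP h v) := by
  rw [LP_apply (g * h), LP_apply h, ← LP_sub]; simp

lemma LP_inv (g : E ≃ᵃⁱ[ℝ] E) (v : E) : LP g (LP g⁻¹ v) = v := by
  rw [← LP_mul, mul_inv_cancel, LP_apply]; simp

lemma LP_div_norm (g h : E ≃ᵃⁱ[ℝ] E) : ‖LP (g * h⁻¹) - 1‖ ≤ ‖LP g - LP h‖ := by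
  refine ContinuousLinearMap.opNorm_le_bound _ (norm_nonneg _) fun x => ?_
  have h1 : (LP (g * h⁻¹) - 1) x = (LP g - LP h) (LP h⁻¹ x) := by
    simp [LP_mul, LP_inv]
  rw [h1, ← LP_norm h⁻¹ x]
  exact ContinuousLinearMap.le_opNorm _ _

variable [FiniteDimensional ℝ E]

lemma step_one {Γ : Subgroup (E ≃ᵃⁱ[ℝ] E)} {D : ℝ}
    (hcc : ∀ v, ∃ g ∈ Γ, dist (g 0) v ≤ D) (u : E) {η : ℝ} (hη : 0 < η) :
    ∃ K : ℝ, ∀ N : ℝ, ∃ k : ℝ, N ≤ k ∧ ∃ β ∈ Γ, ‖LP β - 1‖ ≤ η ∧ ‖β 0 - k • u‖ ≤ K := by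
  choose g hg hd using fun k : ℕ => hcc ((k : ℝ) • u)
  obtain ⟨A, -, φ, hφ, hA⟩ := tendsto_subseq_of_bounded (x := fun k => LP (g k))
    (isBounded_closedBall (x := (0 : E →L[ℝ] E)) (r := 1))
    (fun k => by simpa using LP_opnorm (g k))
  have hC := hA.cauchySeq
  rw [Metric.cauchySeq_iff'] at hC
  obtain ⟨i, hi⟩ := hC η hη
  refine ⟨‖(g (φ i))⁻¹ 0‖ + D, fun N => ?_⟩
  obtain ⟨n, hn⟩ := exists_nat_ge N
  set j := max n i
  refine ⟨(φ j : ℕ), ?_, g (φ j) * (g (φ i))⁻¹, Γ.mul_mem (hg _) (Γ.inv_mem (hg _)), ?_, ?_⟩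
  · refine hn.trans ?_
    exact_mod_cast (le_max_left n i).trans (hφ.id_le j)
  · refine (LP_div_norm _ _).trans ?_
    have := hi j (le_max_right n i)
    rw [dist_eq_norm] at this
    exact this.le
  · have h1 : (g (φ j) * (g (φ i))⁻¹) 0 - (φ j : ℝ) • u
        = LP (g (φ j)) ((g (φ i))⁻¹ 0) + (g (φ j) 0 - (φ j : ℝ) • u) := by
      rw [LP_apply]; simp
    rw [h1]
    refine (norm_add_le _ _).trans ?_
    rw [LP_norm]
    have := hd (φ j)
    rw [dist_eq_norm] at this
    linarith

lemma norm_gap (S : E →L[ℝ] E) (W : Submodule ℝ E) {m : ℝ} (hm : 0 < m)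
    (h : ∀ w ∈ W, w ≠ 0 → ‖S w‖ < m * ‖w‖) :
    ∃ c, 0 ≤ c ∧ c < m ∧ ∀ w ∈ W, ‖S w‖ ≤ c * ‖w‖ := by
  have hK : IsCompact (sphere (0 : E) 1 ∩ W) :=
    (isCompact_sphere 0 1).inter_right W.closed_of_finiteDimensional
  by_cases hne : (sphere (0 : E) 1 ∩ W).Nonempty
  · obtain ⟨x, ⟨hx1, hxW⟩, hx⟩ := hK.exists_isMaxOn hne
      (f := fun x => ‖S x‖) (by fun_prop)
    have hx1 : ‖x‖ = 1 := by simpa using hx1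
    refine ⟨‖S x‖, norm_nonneg _, ?_, fun w hw => ?_⟩
    · have := h x hxW (by intro h0; simp [h0] at hx1)
      rwa [hx1, mul_one] at this
    · by_cases hw0 : w = 0
      · simp [hw0]
      have hwp : 0 < ‖w‖ := norm_pos_iff.2 hw0
      have h1 : ‖w‖⁻¹ • w ∈ sphere (0 : E) 1 ∩ W := by
        refine ⟨?_, W.smul_mem _ hw⟩
        simp [norm_smul, hwp.ne']
      have h2 : ‖S (‖w‖⁻¹ • w)‖ ≤ ‖S x‖ := hx h1
      rw [map_smul, norm_smul, norm_inv, norm_norm, inv_mul_le_iff₀ hwp] at h2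
      linarith
  · refine ⟨0, le_rfl, hm, fun w hw => ?_⟩
    by_cases hw0 : w = 0
    · simp [hw0]
    exfalso
    refine hne ⟨‖w‖⁻¹ • w, ?_, W.smul_mem _ hw⟩
    have hwp : 0 < ‖w‖ := norm_pos_iff.2 hw0
    simp [norm_smul, hwp.ne']

/-- Spectral splitting for `A - 1`, `A` a linear isometry. -/
lemma splitting (g : E ≃ᵃⁱ[ℝ] E) {m : ℝ} (hm : 0 < m) (hmn : ‖LP g - 1‖ = m) :
    ∃ (V : Submodule ℝ E) (c : ℝ), 0 ≤ c ∧ c < m ∧ (∃ u ∈ V, ‖u‖ = 1) ∧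
      (∀ v ∈ V, (LP g - 1) v ∈ V ∧ ‖(LP g - 1) v‖ = m * ‖v‖) ∧
      (∀ w ∈ Vᗮ, (LP g - 1) w ∈ Vᗮ ∧ ‖(LP g - 1) w‖ ≤ c * ‖w‖) := by
  set S := LP g - 1 with hS
  set S' := LP g⁻¹ - 1 with hS'
  have hadj : ∀ x y, inner ℝ (S x) y = inner ℝ x (S' y) := by
    intro x y
    have h1 : inner ℝ (LP g x) y = inner ℝ x (LP g⁻¹ y) := by
      conv_lhs => rw [← LP_inv g y]
      exact (g.linearIsometryEquiv).inner_map_map x (LP g⁻¹ y)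
    simp [hS, hS', inner_sub_left, inner_sub_right, h1]
  have hcomm : ∀ x, S (S' x) = S' (S x) := by
    intro x
    have h1 := LP_inv g x
    have h2 := LP_inv g⁻¹ x
    rw [inv_inv] at h2
    simp [hS, hS', h1, h2]; abel
  have hS'n : ∀ x, ‖S' x‖ ≤ m * ‖x‖ := by
    intro x
    have h1 : S' x = - S (LP g⁻¹ x) := by
      simp [hS, hS', LP_inv]
    rw [h1, norm_neg, ← LP_norm g⁻¹ x, ← hmn]
    exact S.le_opNorm _
  have hSn : ∀ x, ‖S x‖ ≤ m * ‖x‖ := fun x => hmn ▸ S.le_opNorm x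
  have key : ∀ x, ‖S x‖ = m * ‖x‖ → S' (S x) = m ^ 2 • x := by
    intro x hx
    have h1 : ‖S' (S x) - m ^ 2 • x‖ ^ 2 ≤ 0 := by
      rw [norm_sub_sq_real, inner_smul_right, real_inner_comm, ← hadj, real_inner_self_eq_norm_sq,
        norm_smul, Real.norm_of_nonneg (by positivity), hx]
      have h2 := hS'n (S x)
      rw [hx] at h2
      have h3 : ‖S' (S x)‖ ^ 2 ≤ (m * (m * ‖x‖)) ^ 2 := by gcongr
      nlinarith
    have h2 : ‖S' (S x) - m ^ 2 • x‖ = 0 := by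
      have := norm_nonneg (S' (S x) - m ^ 2 • x)
      nlinarith
    exact sub_eq_zero.1 (norm_eq_zero.1 h2)
  let V : Submodule ℝ E := LinearMap.ker ((S' * S - m ^ 2 • (1 : E →L[ℝ] E) : E →L[ℝ] E) : E →ₗ[ℝ] E)
  have hV : ∀ x, x ∈ V ↔ S' (S x) = m ^ 2 • x := by
    intro x
    simp [V, LinearMap.mem_ker, sub_eq_zero]
  have hVn : ∀ v ∈ V, ‖S v‖ = m * ‖v‖ := by
    intro v hv
    have h1 : ‖S v‖ ^ 2 = (m * ‖v‖) ^ 2 := by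
      rw [← real_inner_self_eq_norm_sq, hadj, (hV v).1 hv, inner_smul_right,
        real_inner_self_eq_norm_sq]; ring
    exact (sq_eq_sq₀ (norm_nonneg _) (by positivity)).1 h1
  have hVS : ∀ v ∈ V, S v ∈ V := by
    intro v hv
    rw [hV] at hv ⊢
    rw [← hcomm, hv, map_smul]
  have hVS' : ∀ v ∈ V, S' v ∈ V := by
    intro v hv
    rw [hV] at hv ⊢
    rw [hcomm, hv, map_smul]
  obtain ⟨c, hc0, hcm, hc⟩ := norm_gap S Vᗮ hm (fun w hw hw0 => by
    refine lt_of_le_of_ne (hSn w) fun h => hw0 ?_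
    have h1 : w ∈ V := (hV w).2 (key w h)
    exact inner_self_eq_zero.1 (Submodule.inner_right_of_mem_orthogonal (𝕜 := ℝ) h1 hw))
  refine ⟨V, c, hc0, hcm, ?_, fun v hv => ⟨hVS v hv, hVn v hv⟩, fun w hw => ⟨?_, hc w hw⟩⟩
  · by_contra hcon
    obtain ⟨d, hd0, hdm, hd⟩ := norm_gap S ⊤ hm (fun w _ hw0 => by
      refine lt_of_le_of_ne (hSn w) fun h => hcon ?_
      have hwp : 0 < ‖w‖ := norm_pos_iff.2 hw0
      refine ⟨‖w‖⁻¹ • w, V.smul_mem _ ((hV w).2 (key w h)), ?_⟩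
      simp [norm_smul, hwp.ne'])
    have : ‖S‖ ≤ d := S.opNorm_le_bound hd0 fun x => hd x trivial
    linarith
  · rw [Submodule.mem_orthogonal]
    intro v hv
    rw [real_inner_comm, hadj, real_inner_comm]
    exact Submodule.inner_right_of_mem_orthogonal (hVS' v hv) hw

lemma commutator_step {r : ℝ} (hr : 0 < r) (α β : E ≃ᵃⁱ[ℝ] E) {m c η δ : ℝ}
    (hm : 0 < m) (hm2 : m ≤ 1 / 2) (hmn : ‖LP α - 1‖ = m) {V : Submodule ℝ E}
    (hc0 : 0 ≤ c) (hcm : c < m)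
    (hV : ∀ v ∈ V, (LP α - 1) v ∈ V ∧ ‖(LP α - 1) v‖ = m * ‖v‖)
    (hW : ∀ w ∈ Vᗮ, (LP α - 1) w ∈ Vᗮ ∧ ‖(LP α - 1) w‖ ≤ c * ‖w‖)
    (hη : 0 ≤ η) (hδ : η * (r + 2 * ‖α 0‖) ≤ δ * r) (hηδ : η ≤ δ) (hδm : 4 * δ ≤ m - c)
    (hβ : ‖LP β - 1‖ ≤ η) (hβr : r ≤ ‖β 0‖)
    (hpq : ∃ p ∈ V, ∃ q ∈ Vᗮ, β 0 = p + q ∧ ‖q‖ ≤ ‖p‖) :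
    ∃ β' : E ≃ᵃⁱ[ℝ] E, β' = α * β * (β * α)⁻¹ ∧ ‖LP β' - 1‖ ≤ η ∧ β' 0 ≠ 0 ∧
      (∃ p ∈ V, ∃ q ∈ Vᗮ, β' 0 = p + q ∧ ‖q‖ ≤ ‖p‖) ∧ ‖β' 0‖ ≤ 3 / 4 * ‖β 0‖ := by
  obtain ⟨p, hp, q, hq, hpq, hle⟩ := hpq
  set β' := α * β * (β * α)⁻¹ with hβ'
  have hmul : β' * (β * α) = α * β := inv_mul_cancel_right _ _
  have hSn : ∀ x, ‖(LP α - 1) x‖ ≤ m * ‖x‖ := fun x => hmn ▸ (LP α - 1).le_opNorm x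
  have hBn : ∀ x, ‖(LP β - 1) x‖ ≤ η * ‖x‖ := fun x =>
    ((LP β - 1).le_opNorm x).trans (by gcongr)
  have hB' : ‖LP β' - 1‖ ≤ η := by
    refine ContinuousLinearMap.opNorm_le_bound _ hη fun x => ?_
    have h1 := LP_div_norm (α * β) (β * α)
    set y := LP (β * α)⁻¹ x with hy
    have hyx : ‖y‖ = ‖x‖ := LP_norm _ _
    have h2 : (LP β' - 1) x = (LP α - 1) ((LP β - 1) y) - (LP β - 1) ((LP α - 1) y) := by
      have h3 : LP β' x = LP α (LP β y) := by rw [hβ', LP_mul, LP_mul]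
      have h4 : LP β (LP α y) = x := by rw [← LP_mul, hy, LP_inv]
      simp [h3, h4]; abel
    rw [h2]
    refine (norm_sub_le _ _).trans ?_
    have h5 : ‖(LP α - 1) ((LP β - 1) y)‖ ≤ m * (η * ‖y‖) :=
      (hSn _).trans (by gcongr; exact hBn y)
    have h6 : ‖(LP β - 1) ((LP α - 1) y)‖ ≤ η * (m * ‖y‖) :=
      (hBn _).trans (by gcongr; exact hSn y)
    rw [hyx] at h5 h6
    have h7 : 0 ≤ η * ‖x‖ := by positivity
    nlinarith
  have hB'n : ∀ x, ‖(LP β' - 1) x‖ ≤ η * ‖x‖ := fun x =>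
    ((LP β' - 1).le_opNorm x).trans (by gcongr)
  set b := β 0 with hb
  set a := α 0 with ha
  set ρ := - (LP β' - 1) b - (LP β' - 1) (LP β a) - (LP β - 1) a with hρ
  have hb' : β' 0 = (LP α - 1) b + ρ := by
    have h1 : (β' * (β * α)) 0 = (α * β) 0 := by rw [hmul]
    have h2 : β' (LP β a + b) = LP α b + a := by
      rw [← LP_eq, ← LP_eq]; simpa using h1
    rw [LP_eq β', map_add] at h2
    have h3 : β' 0 = LP α b + a - (LP β' (LP β a) + LP β' b) := by rw [← h2]; abel
    rw [h3, hρ]; simp; abel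
  have hbpos : 0 < ‖b‖ := lt_of_lt_of_le hr hβr
  have hρn : ‖ρ‖ ≤ δ * ‖b‖ := by
    have h1 : ‖ρ‖ ≤ η * ‖b‖ + η * ‖a‖ + η * ‖a‖ := by
      refine (norm_sub_le _ _).trans (add_le_add ((norm_sub_le _ _).trans (add_le_add ?_ ?_)) (hBn a))
      · rw [norm_neg]; exact hB'n b
      · refine (hB'n _).trans ?_
        rw [LP_norm]
    have h2 : η * ‖b‖ + η * ‖a‖ + η * ‖a‖ ≤ δ * ‖b‖ := by
      have h3 : 0 ≤ (‖b‖ - r) * (δ - η) := mul_nonneg (by linarith) (by linarith)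
      nlinarith
    exact h1.trans h2
  have hbp : ‖b‖ ≤ 2 * ‖p‖ := by
    rw [hpq]; refine (norm_add_le _ _).trans (by linarith)
  have hppos : 0 < ‖p‖ := by linarith
  have hδ0 : 0 ≤ δ := hη.trans hηδ
  have hρp : ‖ρ‖ ≤ 2 * δ * ‖p‖ := by nlinarith
  set ρ1 : E := V.starProjection ρ with hρ1
  set ρ2 : E := ρ - ρ1 with hρ2
  have hρ1V : ρ1 ∈ V := Submodule.starProjection_apply_mem _ _
  have hρ2V : ρ2 ∈ Vᗮ := Submodule.sub_starProjection_mem_orthogonal _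
  have hpyth : ‖ρ‖ ^ 2 = ‖ρ1‖ ^ 2 + ‖ρ2‖ ^ 2 := by
    have h1 : ρ = ρ1 + ρ2 := by rw [hρ2]; abel
    conv_lhs => rw [h1]
    rw [norm_add_sq_real, Submodule.inner_right_of_mem_orthogonal hρ1V hρ2V]; ring
  have hρ1n : ‖ρ1‖ ≤ ‖ρ‖ := by
    have := norm_nonneg ρ; have := norm_nonneg ρ1
    exact abs_le_of_sq_le_sq' (by nlinarith [sq_nonneg ‖ρ2‖]) (norm_nonneg _) |>.2
  have hρ2n : ‖ρ2‖ ≤ ‖ρ‖ := by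
    exact abs_le_of_sq_le_sq' (by nlinarith [sq_nonneg ‖ρ1‖]) (norm_nonneg _) |>.2
  set p' := (LP α - 1) p + ρ1 with hp'
  set q' := (LP α - 1) q + ρ2 with hq'
  have hp'V : p' ∈ V := V.add_mem (hV p hp).1 hρ1V
  have hq'V : q' ∈ Vᗮ := Vᗮ.add_mem (hW q hq).1 hρ2V
  have hsum : β' 0 = p' + q' := by
    rw [hb', hpq, map_add, hp', hq', hρ2]; abel
  have hp'n : m * ‖p‖ - 2 * δ * ‖p‖ ≤ ‖p'‖ := by
    have h1 : ‖(LP α - 1) p‖ ≤ ‖p'‖ + ‖ρ1‖ := by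
      have h2 : (LP α - 1) p = p' - ρ1 := by rw [hp']; abel
      rw [h2]; exact norm_sub_le _ _
    rw [(hV p hp).2] at h1
    linarith
  have hq'n : ‖q'‖ ≤ c * ‖p‖ + 2 * δ * ‖p‖ := by
    refine (norm_add_le _ _).trans ?_
    have h1 := (hW q hq).2
    have h2 : c * ‖q‖ ≤ c * ‖p‖ := by gcongr
    linarith
  refine ⟨β', rfl, hB', ?_, ⟨p', hp'V, q', hq'V, hsum, ?_⟩, ?_⟩
  · intro h0
    rw [h0] at hsum
    have h1 : ‖p'‖ ^ 2 = 0 := by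
      rw [← real_inner_self_eq_norm_sq]
      have h2 : p' = - q' := eq_neg_of_add_eq_zero_left hsum.symm
      conv_lhs => rw [h2]
      rw [inner_neg_left, inner_neg_right, neg_neg]
      have h3 := Submodule.inner_right_of_mem_orthogonal (𝕜 := ℝ) hp'V hq'V
      rw [h2, inner_neg_left] at h3
      linarith
    have h2 : ‖p'‖ = 0 := by simpa using h1
    nlinarith
  · nlinarith
  · rw [hb']
    refine (norm_add_le _ _).trans ?_
    have := hSn b
    nlinarith

lemma linear_part_rigid {Γ : Subgroup (E ≃ᵃⁱ[ℝ] E)} {r D : ℝ} (hr : 0 < r)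
    (hfree : ∀ g ∈ Γ, ∀ v, dist (g v) v < r → g = 1)
    (hcc : ∀ v, ∃ g ∈ Γ, dist (g 0) v ≤ D) {α : E ≃ᵃⁱ[ℝ] E} (hα : α ∈ Γ)
    (h : ‖LP α - 1‖ ≤ 1 / 2) : LP α = 1 := by
  by_contra hne
  have hm : 0 < ‖LP α - 1‖ := norm_pos_iff.2 (sub_ne_zero.2 hne)
  obtain ⟨m, hmn⟩ : ∃ m, ‖LP α - 1‖ = m := ⟨_, rfl⟩
  rw [hmn] at h hm
  obtain ⟨V, c, hc0, hcm, ⟨u, huV, hu1⟩, hV, hW⟩ := splitting α hm hmn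
  set δ := (m - c) / 4 with hδ
  have hδ0 : 0 < δ := by rw [hδ]; linarith
  have hden : 0 < r + 2 * ‖α 0‖ := by positivity
  set η := δ * r / (r + 2 * ‖α 0‖) with hη
  have hη0 : 0 < η := by positivity
  have h1 : η * (r + 2 * ‖α 0‖) = δ * r := by rw [hη]; field_simp
  have hηδ : η ≤ δ := by
    rw [hη, div_le_iff₀ hden]
    have : 0 ≤ δ * ‖α 0‖ := by positivity
    nlinarith
  have hbig : ∀ β ∈ Γ, β 0 ≠ 0 → r ≤ ‖β 0‖ := by
    intro β hβ hb
    by_contra hlt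
    push Not at hlt
    have := hfree β hβ 0 (by rwa [dist_zero_right])
    rw [this] at hb
    simp at hb
  obtain ⟨K, hK⟩ := step_one hcc u hη0
  obtain ⟨k, hk, β₀, hβ₀, hB₀, hb₀⟩ := hK (2 * K + 1)
  have hK0 : 0 ≤ K := (norm_nonneg _).trans hb₀
  have hiter : ∀ n : ℕ, ∃ β ∈ Γ, ‖LP β - 1‖ ≤ η ∧ β 0 ≠ 0 ∧
      (∃ p ∈ V, ∃ q ∈ Vᗮ, β 0 = p + q ∧ ‖q‖ ≤ ‖p‖) ∧ ‖β 0‖ ≤ (3 / 4) ^ n * ‖β₀ 0‖ := by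
    intro n
    induction n with
    | zero =>
      have hku : ‖k • u‖ = k := by
        rw [norm_smul, hu1, mul_one, Real.norm_of_nonneg (by linarith)]
      set e := β₀ 0 - k • u with he
      set e1 : E := V.starProjection e with he1
      set e2 : E := e - e1 with he2
      have he1V : e1 ∈ V := Submodule.starProjection_apply_mem _ _
      have he2V : e2 ∈ Vᗮ := Submodule.sub_starProjection_mem_orthogonal _
      have hpyth : ‖e‖ ^ 2 = ‖e1‖ ^ 2 + ‖e2‖ ^ 2 := by
        have h1 : e = e1 + e2 := by rw [he2]; abel
        conv_lhs => rw [h1]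
        rw [norm_add_sq_real, Submodule.inner_right_of_mem_orthogonal he1V he2V]; ring
      have he1n : ‖e1‖ ≤ ‖e‖ :=
        abs_le_of_sq_le_sq' (by nlinarith [sq_nonneg ‖e2‖]) (norm_nonneg _) |>.2
      have he2n : ‖e2‖ ≤ ‖e‖ :=
        abs_le_of_sq_le_sq' (by nlinarith [sq_nonneg ‖e1‖]) (norm_nonneg _) |>.2
      refine ⟨β₀, hβ₀, hB₀, ?_, ⟨k • u + e1, V.add_mem (V.smul_mem _ huV) he1V, e2, he2V, ?_, ?_⟩,
        by simp⟩
      · intro h0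
        rw [he, h0, zero_sub, norm_neg, hku] at hb₀
        linarith
      · rw [he2, he]; abel
      · have h2 : ‖k • u‖ ≤ ‖k • u + e1‖ + ‖e1‖ := by
          have h3 : k • u = (k • u + e1) - e1 := by abel
          conv_lhs => rw [h3]
          exact norm_sub_le _ _
        linarith
    | succ n ih =>
      obtain ⟨β, hβ, hB, hb, hpq, hle⟩ := ih
      obtain ⟨β', rfl, hB', hb', hpq', hle'⟩ := commutator_step hr α β hm h hmn hc0 hcm hV hW hη0.le
        h1.le hηδ (by rw [hδ]; linarith) hB (hbig β hβ hb) hpq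
      refine ⟨_, Γ.mul_mem (Γ.mul_mem hα hβ) (Γ.inv_mem (Γ.mul_mem hβ hα)), hB', hb', hpq', ?_⟩
      rw [pow_succ]
      linarith
  have hlim : Tendsto (fun n : ℕ => (3 / 4 : ℝ) ^ n * ‖β₀ 0‖) atTop (𝓝 (0 * ‖β₀ 0‖)) :=
    (tendsto_pow_atTop_nhds_zero_of_lt_one (by norm_num) (by norm_num)).mul_const _
  rw [zero_mul] at hlim
  obtain ⟨n, hn⟩ := (hlim.eventually (gt_mem_nhds hr)).exists
  obtain ⟨β, hβ, -, hb, -, hle⟩ := hiter n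
  have := hbig β hβ hb
  linarith

lemma finite_reps {X Y : Type*} [PseudoMetricSpace Y] (f : X → Y) (P : Set X)
    (h : TotallyBounded (f '' P)) {ε : ℝ} (hε : 0 < ε) :
    ∃ F : Set X, F.Finite ∧ F ⊆ P ∧ ∀ x ∈ P, ∃ y ∈ F, dist (f x) (f y) < ε := by
  obtain ⟨t, ht, htf, hcov⟩ := h.exists_subset (Metric.dist_mem_uniformity hε)
  have ht2 : ∀ z : t, ∃ x ∈ P, f x = z := fun z => ht z.2
  choose s hsP hs using ht2
  have : Finite t := htf
  refine ⟨range s, finite_range s, by rintro _ ⟨z, rfl⟩; exact hsP z, fun x hx => ?_⟩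
  have := hcov (mem_image_of_mem f hx)
  simp only [mem_iUnion] at this
  obtain ⟨z, hz, hxy⟩ := this
  refine ⟨s ⟨z, hz⟩, mem_range_self _, ?_⟩
  rw [hs]
  exact hxy

/-- The Bieberbach-type finiteness statement. -/
lemma bieberbach {Γ : Subgroup (E ≃ᵃⁱ[ℝ] E)} {r D : ℝ} (hr : 0 < r)
    (hfree : ∀ g ∈ Γ, ∀ v, dist (g v) v < r → g = 1)
    (hcc : ∀ v, ∃ g ∈ Γ, dist (g 0) v ≤ D) :
    ∃ F : Set (E ≃ᵃⁱ[ℝ] E), F.Finite ∧ ∀ g ∈ Γ, ∃ h ∈ F, ∃ t ∈ Γ, ∃ l : E,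
      (∀ x, t x = x + l) ∧ ∀ x, g x = h x + (2 : ℝ) • l := by
  have htr : ∀ g ∈ Γ, ∀ h ∈ Γ, ‖LP g - LP h‖ < 1 / 2 → ∀ x, (g * h⁻¹) x = x + (g 0 - h 0) := by
    intro g hg h hh hlt x
    have hmem := Γ.mul_mem hg (Γ.inv_mem hh)
    have h1 := linear_part_rigid hr hfree hcc hmem ((LP_div_norm g h).trans hlt.le)
    have h2 : ∀ y, (g * h⁻¹) y = y + (g * h⁻¹) 0 := fun y => by
      conv_lhs => rw [LP_eq, h1]
      simp
    have h3 := h2 (h 0)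
    have h4 : (g * h⁻¹) (h 0) = g 0 := by simp
    rw [h4] at h3
    rw [h2 x, h3]; abel
  have hTB : ∀ P : Set (E ≃ᵃⁱ[ℝ] E), TotallyBounded (LP '' P) := fun P =>
    (isCompact_closedBall (0 : E →L[ℝ] E) 1).totallyBounded.subset (by
      rintro _ ⟨g, -, rfl⟩; simpa using LP_opnorm g)
  obtain ⟨F₀, hF₀, hF₀Γ, hF₀c⟩ := finite_reps LP (Γ : Set (E ≃ᵃⁱ[ℝ] E)) (hTB _)
    (ε := 1 / 2) (by norm_num)
  obtain ⟨C, hC⟩ : ∃ C : ℝ, ∀ h ∈ F₀, ‖h 0‖ ≤ C := by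
    obtain ⟨C, hC⟩ := (hF₀.image fun h => ‖h 0‖).bddAbove
    exact ⟨C, fun h hh => hC ⟨h, hh, rfl⟩⟩
  have hlat : ∀ v, ∃ t ∈ Γ, ∃ l : E, (∀ x, t x = x + l) ∧ ‖v - l‖ ≤ D + C := by
    intro v
    obtain ⟨g, hg, hd⟩ := hcc v
    obtain ⟨h, hh, hgh⟩ := hF₀c g hg
    rw [dist_eq_norm] at hgh
    refine ⟨g * h⁻¹, Γ.mul_mem hg (Γ.inv_mem (hF₀Γ hh)), g 0 - h 0,
      htr g hg h (hF₀Γ hh) hgh, ?_⟩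
    have h1 : v - (g 0 - h 0) = (v - g 0) + h 0 := by abel
    rw [h1]
    rw [dist_comm, dist_eq_norm] at hd
    exact (norm_add_le _ _).trans (add_le_add hd (hC h hh))
  set R := 2 * (D + C) with hR
  obtain ⟨F, hF, hFP, hFc⟩ := finite_reps (fun g : E ≃ᵃⁱ[ℝ] E => (LP g, g 0))
    {g | g ∈ Γ ∧ ‖g 0‖ ≤ R} (((isCompact_closedBall (0 : E →L[ℝ] E) 1).prod
      (isCompact_closedBall (0 : E) R)).totallyBounded.subset (by
      rintro _ ⟨g, hg, rfl⟩; exact ⟨by simpa using LP_opnorm g, by simpa using hg.2⟩))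
    (ε := min (1 / 2) r) (by positivity)
  refine ⟨F, hF, fun g hg => ?_⟩
  obtain ⟨t, ht, l, htl, hl⟩ := hlat ((1 / 2 : ℝ) • g 0)
  set h := t⁻¹ * t⁻¹ * g with hh
  have hhΓ : h ∈ Γ := Γ.mul_mem (Γ.mul_mem (Γ.inv_mem ht) (Γ.inv_mem ht)) hg
  have hgh : ∀ x, g x = h x + (2 : ℝ) • l := by
    intro x
    have h1 : t * t * h = g := by rw [hh]; group
    have h2 : g x = t (t (h x)) := by rw [← h1]; simp
    rw [h2, htl, htl, two_smul]; abel
  have hh0 : ‖h 0‖ ≤ R := by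
    have h1 : h 0 = (2 : ℝ) • ((1 / 2 : ℝ) • g 0 - l) := by
      rw [smul_sub, smul_smul, hgh 0]; norm_num
    rw [h1, norm_smul, hR]
    norm_num
    norm_num at hl
    exact hl
  obtain ⟨f, hf, hd⟩ := hFc h ⟨hhΓ, hh0⟩
  rw [Prod.dist_eq, max_lt_iff] at hd
  obtain ⟨hd1, hd2⟩ := hd
  have h1 := htr h hhΓ f (hFP hf).1 (by
    rw [← dist_eq_norm]; exact hd1.trans_le (min_le_left _ _))
  have h2 : h * f⁻¹ = 1 := by
    refine hfree _ (Γ.mul_mem hhΓ (Γ.inv_mem (hFP hf).1)) 0 ?_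
    rw [h1, zero_add, dist_zero_right, ← dist_eq_norm]
    exact hd2.trans_le (min_le_right _ _)
  have h3 : h = f := mul_inv_eq_one.1 h2
  exact ⟨f, hf, t, ht, l, htl, h3 ▸ hgh⟩

end PartH

/-- **Theorem 2.3.** Every compact flat Riemannian manifold (encoded: a compact
connected topological `n`-manifold carrying the geodesic distance of `g`, which
is locally isometric to Euclidean `ℝⁿ`) has finite blocking number. -/
theorem flat_implies_finite_blocking
    (n : ℕ) (M : Type) [MetricSpace M] [CompactSpace M] [ConnectedSpace M]
    [ChartedSpace (EuclideanSpace ℝ (Fin n)) M]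
    (hgeo : GeodesicDistance M)
    (hflat : IsFlat M n) :
    HasFiniteBlocking M := by
  obtain ⟨r, hr, hM⟩ := exists_unifFlat hflat
  obtain ⟨π, h⟩ := exists_cov hr hM
  obtain ⟨D, hD, hcc⟩ := IsCov.cocompact hr h
  obtain ⟨F, hF, hFΓ⟩ := bieberbach (Γ := Deck π) (D := D) hr
    (fun g hg v hv => IsCov.deck_free hr h hg hv)
    (fun v => by
      obtain ⟨w, hw, hwv⟩ := hcc (π v)
      obtain ⟨g, hg, hgw⟩ := IsCov.exists_deck hr hM h hwv
      refine ⟨g, hg, ?_⟩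
      rw [← hgw, g.dist_map, dist_zero_left]
      exact hw.le)
  have hb : ∀ x y : M, blockingNumber x y ≤ F.encard := by
    intro x y
    obtain ⟨u, rfl⟩ := IsCov.surjective hr h x
    obtain ⟨w, rfl⟩ := IsCov.surjective hr h y
    have hbl : Blocks ((fun f : EuclideanSpace ℝ (Fin n) ≃ᵃⁱ[ℝ] EuclideanSpace ℝ (Fin n) =>
        π ((1 / 2 : ℝ) • (u + f w))) '' F) (π u) (π w) := by
      intro γ a hγ h0 ha
      have ha0 : 0 < a := hγ.1
      obtain ⟨v, hv⟩ := IsCov.lift_geodesic hr h hγ h0.symm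
      have h1 : π w = π (u + a • v) := by
        rw [← ha]; exact hv a ⟨ha0.le, le_rfl⟩
      obtain ⟨g, hg, hgw⟩ := IsCov.exists_deck hr hM h h1
      obtain ⟨f, hf, t, ht, l, htl, hgf⟩ := hFΓ g hg
      refine ⟨a / 2, ⟨by linarith, by linarith⟩, f, hf, ?_⟩
      beta_reduce
      rw [hv (a / 2) ⟨by linarith, by linarith⟩]
      have h2 : u + (a / 2) • v = t ((1 / 2 : ℝ) • (u + f w)) := by
        have h3 : u + a • v = f w + (2 : ℝ) • l := by rw [← hgw, hgf]
        have h4 : a • v = f w + (2 : ℝ) • l - u := by rw [← h3]; abel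
        have h5 : (a / 2) • v = (1 / 2 : ℝ) • (a • v) := by rw [smul_smul]; ring_nf
        rw [htl, h5, h4]
        module
      rw [h2]
      exact (ht _).symm
    have hle : blockingNumber (π u) (π w) ≤ _ := sInf_le ⟨_, hbl, rfl⟩
    exact hle.trans (encard_image_le _ _)
  exact lt_of_le_of_lt (iSup_le fun x => iSup_le fun y => hb x y) hF.encard_lt_top
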